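/- arXiv:2109.04750 — 6 statements merged into one kernel-verified Lean document; each statement's English description precedes it below -/
import Mathlib

section
/- For every odd integer i ≥ 3, the polynomial Φ_i ∈ ℤ[u] is monic of degree (i−1)/2, its coefficient of u^{(i−3)/2} equals −1, and its constant term Φ_i(0) equals 1 if i ≡ 1 or 7 (mod 8) and equals −1 if i ≡ 3 or 5 (mod 8). For every even integer i ≥ 4, Φ_i has leading coefficient 1 and degree i/2 − 1, its coefficient of u^{i/2 − 2} equals 0, and its constant term Φ_i(0) equals 0 if 4 ∣ i, equals 1 if i ≡ 2 (mod 8), and equals −1 if i ≡ 6 (mod 8). -/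
open Polynomial

lemma coeff_aux (σ : ℤ → Polynomial ℤ)
    (hσ0 : σ 0 = 0) (hσ1 : σ 1 = 1)
    (hσ : ∀ i : ℤ, σ (i + 1) = X * σ i - σ (i - 1)) (n : ℕ) :
    (∀ m, n < m → (σ (n + 1)).coeff m = 0) ∧ (σ (n + 1)).coeff n = 1 ∧
    (∀ m, n ≤ m → (σ n).coeff m = 0) ∧ (∀ m, m + 1 = n → (σ (n + 1)).coeff m = 0) := by
  induction n with
  | zero =>
    refine ⟨?_, ?_, ?_, ?_⟩
    · intro m hm
      simp [hσ1, coeff_one]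
      omega
    · simp [hσ1]
    · simp [hσ0]
    · simp
  | succ n ih =>
    obtain ⟨h1, h2, h3, h4⟩ := ih
    have e : σ (((n + 1 : ℕ) : ℤ) + 1) = X * σ (n + 1) - σ n := by
      rw [hσ]; push_cast; simp
    rw [e]
    refine ⟨?_, ?_, ?_, ?_⟩
    · intro m hm
      obtain ⟨k, rfl⟩ : ∃ k, m = k + 1 := ⟨m - 1, by omega⟩
      rw [coeff_sub, coeff_X_mul, h1 k (by omega), h3 _ (by omega)]; simp
    · rw [coeff_sub, coeff_X_mul, h2, h3 _ (by omega)]; simp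
    · intro m hm
      push_cast
      exact h1 m (by omega)
    · intro m hm
      obtain rfl : m = n := by omega
      rcases m with _ | k
      · simp [hσ0]
      · rw [coeff_sub, coeff_X_mul, h4 k rfl, h3 _ le_rfl]; simp

lemma eval_aux (σ : ℤ → Polynomial ℤ)
    (hσ0 : σ 0 = 0) (hσ1 : σ 1 = 1)
    (hσ : ∀ i : ℤ, σ (i + 1) = X * σ i - σ (i - 1)) (n : ℕ) :
    ((n : ℤ) % 4 = 0 → (σ n).eval 0 = 0 ∧ (σ (n + 1)).eval 0 = 1) ∧
    ((n : ℤ) % 4 = 1 → (σ n).eval 0 = 1 ∧ (σ (n + 1)).eval 0 = 0) ∧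
    ((n : ℤ) % 4 = 2 → (σ n).eval 0 = 0 ∧ (σ (n + 1)).eval 0 = -1) ∧
    ((n : ℤ) % 4 = 3 → (σ n).eval 0 = -1 ∧ (σ (n + 1)).eval 0 = 0) := by
  induction n with
  | zero => simp [hσ0, hσ1]
  | succ n ih =>
    have e : (σ (((n + 1 : ℕ) : ℤ) + 1)).eval 0 = - (σ n).eval 0 := by
      rw [hσ]; push_cast; simp
    rw [e]
    push_cast
    generalize (σ n).eval 0 = a at *
    generalize (σ (n + 1)).eval 0 = b at *
    omega

/-- For odd `i ≥ 3`, `Φ i` is monic of degree `(i−1)/2`, its coefficient of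
`u^((i−3)/2)` is `−1`, and its constant term is `1` if `i ≡ 1, 7 (mod 8)` and `−1` if
`i ≡ 3, 5 (mod 8)`. For even `i ≥ 4`, `Φ i` has leading coefficient `1` and degree
`i/2 − 1`, its coefficient of `u^(i/2 − 2)` is `0`, and its constant term is `0` if `4 ∣ i`,
`1` if `i ≡ 2 (mod 8)`, and `−1` if `i ≡ 6 (mod 8)`. -/
theorem stmt1
    (σ : ℤ → Polynomial ℤ)
    (hσ0 : σ 0 = 0) (hσ1 : σ 1 = 1)
    (hσ : ∀ i : ℤ, σ (i + 1) = X * σ i - σ (i - 1))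
    (Φ : ℤ → Polynomial ℤ)
    (hΦeven : ∀ i : ℤ, Φ (2 * i) = σ i)
    (hΦodd : ∀ i : ℤ, Φ (2 * i - 1) = σ i - σ (i - 1)) :
    (∀ i : ℤ, 3 ≤ i → Odd i →
      (Φ i).Monic ∧
      (Φ i).natDegree = ((i - 1) / 2).toNat ∧
      (Φ i).coeff ((i - 3) / 2).toNat = -1 ∧
      ((i % 8 = 1 ∨ i % 8 = 7) → (Φ i).eval 0 = 1) ∧
      ((i % 8 = 3 ∨ i % 8 = 5) → (Φ i).eval 0 = -1)) ∧
    (∀ i : ℤ, 4 ≤ i → Even i →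
      (Φ i).leadingCoeff = 1 ∧
      (Φ i).natDegree = (i / 2 - 1).toNat ∧
      (Φ i).coeff (i / 2 - 2).toNat = 0 ∧
      ((4 : ℤ) ∣ i → (Φ i).eval 0 = 0) ∧
      (i % 8 = 2 → (Φ i).eval 0 = 1) ∧
      (i % 8 = 6 → (Φ i).eval 0 = -1)) := by
  constructor
  · intro i hi ho
    obtain ⟨n, rfl⟩ : ∃ n : ℕ, i = 2 * ((n : ℤ) + 1 + 1) - 1 := by
      obtain ⟨k, rfl⟩ := ho
      exact ⟨(k - 1).toNat, by omega⟩
    have e1 : ((2 * ((n : ℤ) + 1 + 1) - 1 - 1) / 2).toNat = n + 1 := by omega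
    have e2 : ((2 * ((n : ℤ) + 1 + 1) - 1 - 3) / 2).toNat = n := by omega
    rw [e1, e2, hΦodd, add_sub_cancel_right]
    obtain ⟨h1, h2, h3, h4⟩ := coeff_aux σ hσ0 hσ1 hσ (n + 1)
    obtain ⟨-, g2, -, -⟩ := coeff_aux σ hσ0 hσ1 hσ n
    have E := eval_aux σ hσ0 hσ1 hσ (n + 1)
    push_cast at h1 h2 h3 h4 E
    have c1 : (σ ((n : ℤ) + 1 + 1) - σ (n + 1)).coeff (n + 1) = 1 := by
      rw [coeff_sub, h2, h3 _ le_rfl]; simp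
    have hd : (σ ((n : ℤ) + 1 + 1) - σ (n + 1)).natDegree = n + 1 := by
      apply natDegree_eq_of_le_of_coeff_ne_zero
      · rw [natDegree_le_iff_coeff_eq_zero]
        intro m hm
        rw [coeff_sub, h1 m hm, h3 m hm.le]; simp
      · rw [c1]; simp
    refine ⟨?_, hd, ?_, ?_, ?_⟩
    · rw [Monic, leadingCoeff, hd, c1]
    · rw [coeff_sub, h4 n rfl, g2]; simp
    · rw [eval_sub]
      generalize (σ ((n : ℤ) + 1 + 1)).eval 0 = a at *
      generalize (σ ((n : ℤ) + 1)).eval 0 = b at *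
      omega
    · rw [eval_sub]
      generalize (σ ((n : ℤ) + 1 + 1)).eval 0 = a at *
      generalize (σ ((n : ℤ) + 1)).eval 0 = b at *
      omega
  · intro i hi ho
    obtain ⟨n, rfl⟩ : ∃ n : ℕ, i = 2 * ((n : ℤ) + 1 + 1) := by
      obtain ⟨k, rfl⟩ := ho
      exact ⟨(k - 2).toNat, by omega⟩
    have e1 : ((2 * ((n : ℤ) + 1 + 1)) / 2 - 1).toNat = n + 1 := by omega
    have e2 : ((2 * ((n : ℤ) + 1 + 1)) / 2 - 2).toNat = n := by omega
    rw [e1, e2, hΦeven]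
    obtain ⟨h1, h2, h3, h4⟩ := coeff_aux σ hσ0 hσ1 hσ (n + 1)
    have E := eval_aux σ hσ0 hσ1 hσ (n + 1)
    push_cast at h1 h2 h3 h4 E
    have hd : (σ ((n : ℤ) + 1 + 1)).natDegree = n + 1 := by
      apply natDegree_eq_of_le_of_coeff_ne_zero
      · rw [natDegree_le_iff_coeff_eq_zero]
        exact h1
      · rw [h2]; simp
    refine ⟨?_, hd, h4 n rfl, ?_⟩
    · rw [leadingCoeff, hd, h2]
    · generalize (σ ((n : ℤ) + 1 + 1)).eval 0 = a at *
      generalize (σ ((n : ℤ) + 1)).eval 0 = b at *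
      omega
end

section
/- Let t ≥ 3 be an odd integer. Then f_t(R,Z), viewed as a polynomial in R with coefficients in ℤ[Z], is monic of degree t in R and has degree 2 in Z; it contains only even powers of Z (that is, f_t(R,Z) = f_t(R,−Z)); its coefficient of R^{t−1} equals 1 − Z²; and its constant term in R satisfies f_t(0,Z) = 1 − Z² if t ≡ 1 (mod 4) and f_t(0,Z) = −1 if t ≡ 3 (mod 4). -/
open Polynomial

lemma sigma_coeffs (σ : ℤ → Polynomial ℤ)
    (hσ0 : σ 0 = 0) (hσ1 : σ 1 = 1)
    (hσ : ∀ i : ℤ, σ (i + 1) = X * σ i - σ (i - 1)) (n : ℕ) :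
    (σ (-(n : ℤ)) = - σ n ∧ σ (-((n : ℤ) + 1)) = - σ (n + 1)) ∧
    ((∀ k, n ≤ k → (σ n).coeff k = 0) ∧ (∀ k, n + 1 ≤ k → (σ (n + 1)).coeff k = 0)) ∧
    ((∀ k, k + 1 = n → (σ n).coeff k = 1) ∧ (σ (n + 1)).coeff n = 1) ∧
    ((∀ k, k + 2 = n → (σ n).coeff k = 0) ∧ (∀ k, k + 1 = n → (σ (n + 1)).coeff k = 0)) ∧
    ((n % 2 = 0 → (σ n).coeff 0 = 0 ∧ (σ (n + 1)).coeff 0 ^ 2 = 1) ∧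
     (n % 2 = 1 → (σ n).coeff 0 ^ 2 = 1 ∧ (σ (n + 1)).coeff 0 = 0)) := by
  induction n with
  | zero =>
    have h := hσ 0
    have hm : σ (-1) = -1 := by
      simp [hσ0, hσ1] at h
      rw [h]; ring
    simp only [Nat.cast_zero, zero_add, neg_zero, hσ0, hσ1, hm]
    refine ⟨by simp, ⟨by simp, ?_⟩, by simp, by simp, by simp⟩
    intro k hk
    rw [coeff_one, if_neg (by omega)]
  | succ n ih =>
    obtain ⟨⟨a1, a2⟩, ⟨b1, b2⟩, ⟨c1, c2⟩, ⟨d1, d2⟩, e1, e2⟩ := ih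
    have h := hσ (n + 1)
    rw [add_sub_cancel_right] at h
    have h' := hσ (-((n : ℤ) + 1))
    rw [show -((n : ℤ) + 1) + 1 = -n by ring,
      show -((n : ℤ) + 1) - 1 = -(n + 1 + 1) by ring, a1, a2] at h'
    push_cast
    refine ⟨⟨a2, ?_⟩, ⟨b2, ?_⟩, ⟨?_, ?_⟩, ⟨?_, ?_⟩, ?_, ?_⟩
    · rw [h]; linear_combination h'
    · rintro (_ | k) hk
      · omega
      · rw [h, coeff_sub, coeff_X_mul, b2 k (by omega), b1 _ (by omega)]; simp
    · intro k hk
      obtain rfl : k = n := by omega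
      exact c2
    · rw [h, coeff_sub, coeff_X_mul, c2, b1 _ (by omega)]; simp
    · intro k hk
      exact d2 k (by omega)
    · rintro (_ | k) hk
      · obtain rfl : n = 0 := by omega
        rw [h, coeff_sub, coeff_X_mul_zero, b1 _ (by omega)]; simp
      · rw [h, coeff_sub, coeff_X_mul, d2 k (by omega), b1 _ (by omega)]; simp
    · intro hn
      obtain ⟨p, q⟩ := e2 (by omega)
      refine ⟨q, ?_⟩
      rw [h, coeff_sub, coeff_X_mul_zero, zero_sub, neg_sq, p]
    · intro hn
      obtain ⟨p, q⟩ := e1 (by omega)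
      refine ⟨q, ?_⟩
      rw [h, coeff_sub, coeff_X_mul_zero, p, sub_zero]

/-- For odd `t ≥ 3`, the polynomial `f_t(R,Z)` (outer variable `R`, inner
variable `Z`, so an element of `(ℤ[Z])[R]`) is monic of degree `t` in `R`, has degree `2`
in `Z`, contains only even powers of `Z` (i.e. `f_t(R,Z) = f_t(R,−Z)`), has coefficient of
`R^(t−1)` equal to `1 − Z²`, and its constant term in `R` is `1 − Z²` if `t ≡ 1 (mod 4)`
and `−1` if `t ≡ 3 (mod 4)`. Here `f_t(R,Z) = Φ_t(R)·Φ_{−t−1}(R)·((Z²−2) − R) − 1`. -/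
theorem stmt2
    (σ : ℤ → Polynomial ℤ)
    (hσ0 : σ 0 = 0) (hσ1 : σ 1 = 1)
    (hσ : ∀ i : ℤ, σ (i + 1) = X * σ i - σ (i - 1))
    (Φ : ℤ → Polynomial ℤ)
    (hΦeven : ∀ i : ℤ, Φ (2 * i) = σ i)
    (hΦodd : ∀ i : ℤ, Φ (2 * i - 1) = σ i - σ (i - 1))
    (t : ℕ) (ht3 : 3 ≤ t) (htodd : Odd t)
    (f : Polynomial (Polynomial ℤ))
    (hf : f = ((Φ t).map (Int.castRingHom (Polynomial ℤ)))
            * ((Φ (-(t : ℤ) - 1)).map (Int.castRingHom (Polynomial ℤ)))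
            * (C (X ^ 2 - 2) - X) - 1) :
    f.Monic ∧
    f.natDegree = t ∧
    (∀ i : ℕ, (f.coeff i).natDegree ≤ 2) ∧ (∃ i : ℕ, (f.coeff i).natDegree = 2) ∧
    (∀ i : ℕ, (f.coeff i).comp (-X) = f.coeff i) ∧
    f.coeff (t - 1) = 1 - X ^ 2 ∧
    (t % 4 = 1 → f.coeff 0 = 1 - X ^ 2) ∧
    (t % 4 = 3 → f.coeff 0 = -1) := by
  obtain ⟨m, rfl⟩ := htodd
  obtain ⟨m, rfl⟩ : ∃ k, m = k + 1 := ⟨m - 1, by omega⟩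
  obtain ⟨⟨a1, a2⟩, ⟨b1, b2⟩, ⟨c1, c2⟩, ⟨d1, d2⟩, e1, e2⟩ :=
    sigma_coeffs σ hσ0 hσ1 hσ (m + 1)
  have h1 : Φ ((2 * (m + 1) + 1 : ℕ) : ℤ) = σ ((m + 1 : ℕ) + 1) - σ (m + 1 : ℕ) := by
    have := hΦodd ((m + 1 : ℕ) + 1)
    rw [add_sub_cancel_right] at this
    rw [← this]; congr 1; push_cast; ring
  have h2 : Φ (-((2 * (m + 1) + 1 : ℕ) : ℤ) - 1) = -σ ((m + 1 : ℕ) + 1) := by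
    rw [← a2, ← hΦeven]; congr 1
  rw [h1, h2] at hf
  generalize σ ((m + 1 : ℕ) + 1) = P at *
  generalize σ ((m + 1 : ℕ)) = Q at *
  obtain ⟨G, hG⟩ : ∃ G, G = (P - Q) * P := ⟨_, rfl⟩
  have hPd : P.natDegree ≤ m + 1 := natDegree_le_iff_coeff_eq_zero.2 fun k hk => b2 k (by omega)
  have hAd : (P - Q).natDegree ≤ m + 1 := natDegree_le_iff_coeff_eq_zero.2 fun k hk => by
    rw [coeff_sub, b2 k (by omega), b1 k (by omega), sub_zero]
  have hA1 : (P - Q).coeff (m + 1) = 1 := by rw [coeff_sub, c2, b1 _ le_rfl, sub_zero]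
  have hPm : P.Monic := monic_of_natDegree_le_of_coeff_eq_one _ hPd c2
  have hAm : (P - Q).Monic := monic_of_natDegree_le_of_coeff_eq_one _ hAd hA1
  have hPd' : P.natDegree = m + 1 := natDegree_eq_of_le_of_coeff_ne_zero hPd (by simp [c2])
  have hAd' : (P - Q).natDegree = m + 1 := natDegree_eq_of_le_of_coeff_ne_zero hAd (by simp [hA1])
  have hGm : G.Monic := hG ▸ hAm.mul hPm
  have hGd : G.natDegree = 2 * m + 2 := by
    rw [hG, hAm.natDegree_mul hPm, hPd', hAd']; ring
  have hGt : G.coeff (2 * m + 2) = 1 := by rw [← hGd]; exact hGm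
  have hGn : G.coeff (2 * m + 1) = -1 := by
    have := hAm.nextCoeff_mul hPm
    rw [← hG, nextCoeff_of_natDegree_pos (by omega), nextCoeff_of_natDegree_pos (by omega),
      nextCoeff_of_natDegree_pos (by omega), hGd, hPd', hAd', coeff_sub] at this
    simpa [d2, c1] using this
  have hG0 : ∀ k, 2 * m + 2 < k → G.coeff k = 0 := fun k hk =>
    coeff_eq_zero_of_natDegree_lt (by omega)
  have hf' : f = (G.map (Int.castRingHom (Polynomial ℤ))) * (X - C (X ^ 2 - 2)) - 1 := by
    rw [hf, hG, Polynomial.map_mul, Polynomial.map_neg]; ring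
  have f0 : f.coeff 0 = - (C (G.coeff 0) * (X ^ 2 - 2)) - 1 := by
    rw [hf', mul_sub, coeff_sub, coeff_sub, coeff_mul_X_zero, coeff_mul_C, coeff_map,
      coeff_one_zero]
    simp
  have fs : ∀ k, f.coeff (k + 1) = C (G.coeff k) - C (G.coeff (k + 1)) * (X ^ 2 - 2) := by
    intro k
    rw [hf', mul_sub, coeff_sub, coeff_sub, coeff_mul_X, coeff_mul_C, coeff_map, coeff_map,
      coeff_one, if_neg (by omega)]
    simp
  have ft : f.coeff (2 * m + 3) = 1 := by
    rw [fs (2 * m + 2), hGt, hG0 _ (by omega)]; simp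
  have fn : f.coeff (2 * m + 2) = 1 - X ^ 2 := by
    rw [fs (2 * m + 1), hGt, hGn]; simp; ring
  have fd : f.natDegree ≤ 2 * m + 3 := natDegree_le_iff_coeff_eq_zero.2 fun k hk => by
    obtain ⟨j, rfl⟩ : ∃ j, k = j + 1 := ⟨k - 1, by omega⟩
    rw [fs, hG0 _ (by omega), hG0 _ (by omega)]; simp
  have key : ∀ i, ∃ a b : ℤ, f.coeff i = C a * X ^ 2 + C b := by
    rintro (_ | k)
    · refine ⟨-G.coeff 0, 2 * G.coeff 0 - 1, ?_⟩
      rw [f0]; simp; ring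
    · refine ⟨-G.coeff (k + 1), G.coeff k + 2 * G.coeff (k + 1), ?_⟩
      rw [fs]; simp; ring
  have hG00 : G.coeff 0 = (P.coeff 0 - Q.coeff 0) * P.coeff 0 := by
    rw [hG, mul_coeff_zero, coeff_sub]
  refine ⟨monic_of_natDegree_le_of_coeff_eq_one _ fd ft, ?_, ?_, ⟨2 * m + 2, ?_⟩, ?_, fn, ?_, ?_⟩
  · exact natDegree_eq_of_le_of_coeff_ne_zero fd (ft.trans_ne one_ne_zero)
  · intro i
    obtain ⟨a, b, h⟩ := key i
    rw [h]; compute_degree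
  · rw [fn]; compute_degree!
  · intro i
    obtain ⟨a, b, h⟩ := key i
    rw [h]; simp
  · intro h
    obtain ⟨p, q⟩ := e1 (by omega)
    have : G.coeff 0 = 1 := by rw [hG00, p]; linear_combination q
    rw [f0, this]; simp; ring
  · intro h
    obtain ⟨p, q⟩ := e2 (by omega)
    have : G.coeff 0 = 0 := by rw [hG00, q]; ring
    rw [f0, this]; simp
end

section
/- Let t ≥ 3 be an odd integer. Then in the field of rational functions ℚ(x) (equivalently, for every nonzero x in any field of characteristic zero), x² · f_t(2, x + x⁻¹) = −Δ_t(x²), i.e. f_t(2, x + x⁻¹) = −( ((t+1)/2)·x² − t + ((t+1)/2)·x⁻² ). -/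
open Polynomial

/-- For odd `t ≥ 3` and every nonzero `x` in a field of characteristic zero,
`x² · f_t(2, x + x⁻¹) = −Δ_t(x²)`, i.e.
`f_t(2, x + x⁻¹) = −(((t+1)/2)·x² − t + ((t+1)/2)·x⁻²)`. -/
theorem stmt4
    (σ : ℤ → Polynomial ℤ)
    (hσ0 : σ 0 = 0) (hσ1 : σ 1 = 1)
    (hσ : ∀ i : ℤ, σ (i + 1) = X * σ i - σ (i - 1))
    (Φ : ℤ → Polynomial ℤ)
    (hΦeven : ∀ i : ℤ, Φ (2 * i) = σ i)
    (hΦodd : ∀ i : ℤ, Φ (2 * i - 1) = σ i - σ (i - 1))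
    (t : ℕ) (ht3 : 3 ≤ t) (htodd : Odd t)
    (f : Polynomial (Polynomial ℤ))
    (hf : f = ((Φ t).map (Int.castRingHom (Polynomial ℤ)))
            * ((Φ (-(t : ℤ) - 1)).map (Int.castRingHom (Polynomial ℤ)))
            * (C (X ^ 2 - 2) - X) - 1)
    (Δ : Polynomial ℤ)
    (hΔ : Δ = C (((t : ℤ) + 1) / 2) * X ^ 2 - C (t : ℤ) * X + C (((t : ℤ) + 1) / 2))
    (K : Type*) [Field K] [CharZero K] (x : K) (hx : x ≠ 0) :
    x ^ 2 * (aeval (x + x⁻¹) (f.eval (2 : Polynomial ℤ))) = -(aeval (x ^ 2) Δ) ∧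
    (aeval (x + x⁻¹) (f.eval (2 : Polynomial ℤ)))
      = -((((t : K) + 1) / 2) * x ^ 2 - (t : K) + (((t : K) + 1) / 2) * x⁻¹ ^ 2) := by
  have hs : ∀ n : ℕ, ((σ n).eval 2 = (n : ℤ) ∧ (σ (n + 1)).eval 2 = (n : ℤ) + 1) ∧
      ((σ (-n)).eval 2 = -(n : ℤ) ∧ (σ (-n + 1)).eval 2 = -(n : ℤ) + 1) := by
    intro n
    induction n with
    | zero => simp [hσ0, hσ1]
    | succ n ih =>
      obtain ⟨⟨h1, h2⟩, h3, h4⟩ := ih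
      have e1 := congrArg (eval 2) (hσ ((n : ℤ) + 1))
      have e2 := congrArg (eval 2) (hσ (-(n : ℤ)))
      rw [add_sub_cancel_right] at e1
      simp only [eval_sub, eval_mul, eval_X, h1, h2] at e1
      simp only [eval_sub, eval_mul, eval_X, h3, h4] at e2
      push_cast
      have a1 : -((n : ℤ) + 1) = -n - 1 := by ring
      have a2 : -(n : ℤ) - 1 + 1 = -n := by ring
      rw [a1, a2]
      refine ⟨⟨h2, ?_⟩, ?_, ?_⟩ <;> linarith
  obtain ⟨k, hk⟩ := htodd
  have hp : (Φ t).eval 2 = 1 := by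
    have a : (t : ℤ) = 2 * ((k : ℤ) + 1) - 1 := by rw [hk]; push_cast; ring
    rw [a, hΦodd, add_sub_cancel_right, eval_sub, (hs k).1.1, (hs k).1.2]; ring
  have hq : (Φ (-(t : ℤ) - 1)).eval 2 = -((k : ℤ) + 1) := by
    have a : -(t : ℤ) - 1 = 2 * (-((k + 1 : ℕ) : ℤ)) := by rw [hk]; push_cast; ring
    rw [a, hΦeven, (hs (k + 1)).2.1]; push_cast; ring
  have hm : ∀ p : Polynomial ℤ, (p.map (Int.castRingHom (Polynomial ℤ))).eval 2
      = ((p.eval 2 : ℤ) : Polynomial ℤ) := by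
    intro p
    have := eval_intCast_map (Int.castRingHom (Polynomial ℤ)) p 2
    simpa using this
  have hfe : f.eval (2 : Polynomial ℤ) = -((k : Polynomial ℤ) + 1) * (X ^ 2 - 4) - 1 := by
    rw [hf]
    simp only [eval_sub, eval_mul, hm, hp, hq, eval_C, eval_X, eval_one]
    push_cast; ring
  have hd : ((t : ℤ) + 1) / 2 = k + 1 := by omega
  have htk : (t : K) = 2 * k + 1 := by rw [hk]; push_cast; ring
  rw [hfe, hΔ, hd]
  simp only [map_sub, map_mul, map_neg, map_add, map_pow, aeval_X, map_natCast, map_one,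
    map_ofNat, htk, Int.cast_natCast]
  constructor <;> field_simp <;> ring
end

section
/- Let p and q be distinct odd rational primes and t an odd positive integer with pq ∣ (t+1)/2 and t ≡ −1 (mod pq), and let w and y be as defined. Then: (1) w² is a root of Δ_t; and (2) for every odd positive integer n, the complex number i·(ȳⁿ − yⁿ) is a rational integer, congruent to 1 modulo pq when n ≡ 1 (mod 4) and congruent to −1 modulo pq when n ≡ 3 (mod 4). -/
open Polynomial Complex

lemma aux_seq (N t k : ℤ) (ht : t ≡ -1 [ZMOD N]) (hk : k ≡ 0 [ZMOD N]) (y z : ℂ)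
    (h1 : y * z = k) (h2 : y ^ 2 + z ^ 2 = t) (h3 : I * (z - y) = 1) (j : ℕ) :
    (∃ m : ℤ, (m : ℂ) = I * (z ^ (2 * j + 1) - y ^ (2 * j + 1)) ∧ m ≡ (-1) ^ j [ZMOD N]) ∧
    (∃ m : ℤ, (m : ℂ) = I * (z ^ (2 * (j + 1) + 1) - y ^ (2 * (j + 1) + 1)) ∧
      m ≡ (-1) ^ (j + 1) [ZMOD N]) := by
  induction j with
  | zero =>
    refine ⟨⟨1, ?_, ?_⟩, ⟨t + k, ?_, ?_⟩⟩
    · simp [h3]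
    · simp [Int.ModEq.refl]
    · push_cast
      rw [← h1, ← h2]
      linear_combination (-(y ^ 2 + z ^ 2 + y * z)) * h3
    · simpa using ht.add hk
  | succ j ih =>
    obtain ⟨⟨a, ha, ha'⟩, ⟨b, hb, hb'⟩⟩ := ih
    refine ⟨⟨b, hb, hb'⟩, ⟨t * b - k ^ 2 * a, ?_, ?_⟩⟩
    · push_cast
      rw [ha, hb, ← h1, ← h2]
      ring
    · have := (ht.mul hb').sub ((hk.pow 2).mul ha')
      refine this.trans ?_
      have e : (-1 : ℤ) * (-1) ^ (j + 1) - 0 ^ 2 * (-1) ^ j = (-1) ^ (j + 1 + 1) := by ring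
      rw [e]

/-- With `p, q` distinct odd primes, `t` odd positive, `pq ∣ (t+1)/2`,
`t ≡ −1 (mod pq)`, and `w = (√(2t+1) + i)/√(2(t+1))`, `y = √((t+1)/2)·w`: (1) `w²` is a
root of `Δ_t`; (2) for every odd positive `n`, `i·(ȳⁿ − yⁿ)` is a rational integer,
congruent to `1 (mod pq)` when `n ≡ 1 (mod 4)` and to `−1 (mod pq)` when `n ≡ 3 (mod 4)`. -/
theorem stmt10
    (p q : ℕ) (hp : p.Prime) (hq : q.Prime) (hpodd : Odd p) (hqodd : Odd q)
    (hpq : p ≠ q)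
    (t : ℕ) (ht : 0 < t) (htodd : Odd t)
    (hdvd : p * q ∣ (t + 1) / 2)
    (htmod : (t : ℤ) ≡ -1 [ZMOD ((p : ℤ) * q)])
    (Δ : Polynomial ℤ)
    (hΔ : Δ = C (((t : ℤ) + 1) / 2) * X ^ 2 - C (t : ℤ) * X + C (((t : ℤ) + 1) / 2))
    (w y : ℂ)
    (hw : w = ((Real.sqrt (2 * (t : ℝ) + 1) : ℂ) + I) / (Real.sqrt (2 * ((t : ℝ) + 1)) : ℂ))
    (hy : y = (Real.sqrt (((t : ℝ) + 1) / 2) : ℂ) * w) :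
    (aeval (w ^ 2)) Δ = 0 ∧
    ∀ n : ℕ, 0 < n → Odd n →
      ∃ m : ℤ, (m : ℂ) = I * ((starRingEnd ℂ) (y ^ n) - y ^ n) ∧
        (n % 4 = 1 → m ≡ 1 [ZMOD ((p : ℤ) * q)]) ∧
        (n % 4 = 3 → m ≡ -1 [ZMOD ((p : ℤ) * q)]) := by
  obtain ⟨r, hr⟩ := htodd
  have hkN : (t + 1) / 2 = r + 1 := by omega
  have hkZ : ((t : ℤ) + 1) / 2 = r + 1 := by omega
  rw [hkN] at hdvd
  rw [hkZ] at hΔ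
  have hk0 : ((r : ℤ) + 1) ≡ 0 [ZMOD ((p : ℤ) * q)] := by
    rw [Int.modEq_zero_iff_dvd]
    exact_mod_cast hdvd
  have htR : (t : ℝ) = 2 * r + 1 := by rw [hr]; push_cast; ring
  have htC : (t : ℂ) = 2 * r + 1 := by rw [hr]; push_cast; ring
  have hr0 : (0 : ℝ) ≤ r := Nat.cast_nonneg r
  have hrC : (r : ℂ) + 1 ≠ 0 := by exact_mod_cast Nat.succ_ne_zero r
  obtain ⟨s, hs⟩ : ∃ s : ℝ, s = Real.sqrt (2 * (t : ℝ) + 1) := ⟨_, rfl⟩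
  obtain ⟨u, hu⟩ : ∃ u : ℝ, u = Real.sqrt (((t : ℝ) + 1) / 2) := ⟨_, rfl⟩
  have hs2 : s ^ 2 = 4 * r + 3 := by
    rw [hs, Real.sq_sqrt (by positivity), htR]; ring
  have hu2 : u ^ 2 = r + 1 := by
    rw [hu, Real.sq_sqrt (by positivity), htR]; ring
  have hu0 : 0 < u := by rw [hu]; positivity
  have hv : Real.sqrt (2 * ((t : ℝ) + 1)) = 2 * u := by
    rw [Real.sqrt_eq_iff_mul_self_eq (by positivity) (by positivity)]
    rw [htR]; linear_combination (-4) * hu2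
  rw [← hs, hv] at hw
  rw [← hu] at hy
  have hs2C : (s : ℂ) ^ 2 = 4 * r + 3 := by exact_mod_cast hs2
  have hu2C : (u : ℂ) ^ 2 = r + 1 := by exact_mod_cast hu2
  have huC : (u : ℂ) ≠ 0 := by exact_mod_cast hu0.ne'
  have hy' : y = (s + I) / 2 := by
    rw [hy, hw]; push_cast; field_simp
  have hz : (starRingEnd ℂ) y = (s - I) / 2 := by
    rw [hy', map_div₀, map_add, conj_ofReal, conj_I, map_ofNat, sub_eq_add_neg]
  have hI : I ^ 2 = -1 := I_sq
  have h1 : y * (starRingEnd ℂ) y = ((r + 1 : ℤ) : ℂ) := by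
    rw [hz, hy']; push_cast; linear_combination hs2C / 4 - hI / 4
  have h2 : y ^ 2 + (starRingEnd ℂ) y ^ 2 = ((t : ℤ) : ℂ) := by
    rw [hz, hy']; push_cast; rw [htC]; linear_combination hs2C / 2 + hI / 2
  have h3 : I * ((starRingEnd ℂ) y - y) = 1 := by
    rw [hz, hy']; linear_combination - hI
  refine ⟨?_, ?_⟩
  · have hyw : y ^ 2 = (r + 1) * w ^ 2 := by rw [hy, mul_pow, hu2C]
    have h4 : y ^ 4 - t * y ^ 2 + (r + 1) ^ 2 = 0 := by
      push_cast at h1 h2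
      rw [← h1, ← h2]; ring
    have h5 : ((r : ℂ) + 1) * ((r + 1) * (w ^ 2) ^ 2 - t * w ^ 2 + (r + 1)) = 0 := by
      linear_combination h4 - (y ^ 2 + (r + 1) * w ^ 2 - t) * hyw
    rw [hΔ]
    simpa [hrC] using h5
  · intro n hn hodd
    obtain ⟨j, rfl⟩ := hodd
    obtain ⟨⟨m, hm, hm'⟩, -⟩ := aux_seq _ _ _ htmod hk0 _ _ h1 h2 h3 j
    refine ⟨m, by rw [hm, map_pow], fun h => ?_, fun h => ?_⟩
    · rwa [Even.neg_one_pow (by rw [Nat.even_iff]; omega)] at hm'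
    · rwa [Odd.neg_one_pow (by rw [Nat.odd_iff]; omega)] at hm'
end

section
/- Let t ≥ 3 be an odd integer. Then for every positive integer m, the two-variable polynomial f_t(R, Z^m) is irreducible in ℂ[R,Z] (absolutely irreducible). -/
open Polynomial

lemma aux_irreducible_of_reverse {S : Type*} [CommRing S] [IsDomain S] {G : S[X]}
    (h0 : G.coeff 0 ≠ 0) (h : Irreducible G.reverse) : Irreducible G := by
  have key : ∀ g : S[X], g.coeff 0 ≠ 0 → IsUnit g.reverse → IsUnit g := by
    intro g hg hu
    have h1 := natDegree_eq_reverse_natDegree_add_natTrailingDegree g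
    have h2 : g.natTrailingDegree = 0 := natTrailingDegree_eq_zero.mpr (Or.inr hg)
    rw [natDegree_eq_zero_of_isUnit hu, h2] at h1
    obtain ⟨c, rfl⟩ := natDegree_eq_zero.mp h1
    simpa using hu
  constructor
  · intro hu
    apply h.not_isUnit
    obtain ⟨c, rfl⟩ := natDegree_eq_zero.mp (natDegree_eq_zero_of_isUnit hu)
    simpa using hu
  · intro a b hab
    rw [hab, mul_coeff_zero] at h0
    rw [hab, reverse_mul_of_domain] at h
    rcases h.isUnit_or_isUnit rfl with h' | h'
    · exact Or.inl (key a (left_ne_zero_of_mul h0) h')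
    · exact Or.inr (key b (right_ne_zero_of_mul h0) h')

lemma aux_eisenstein (P : ℂ[X]) (r : ℂ) (hr : P.eval r = 0) (hd : P.derivative.eval r ≠ 0)
    (Q : ℂ[X]) (n : ℕ) (hn : 0 < n) :
    Irreducible (C P * X ^ n + C (P * Q - 1) : ℂ[X][X]) := by
  have hQr : (P * Q - 1).eval r ≠ 0 := by simp [hr]
  have hQ : P * Q - 1 ≠ 0 := by
    intro h; rw [h] at hQr; simp at hQr
  have hP : P ≠ 0 := by
    intro h; rw [h] at hd; simp at hd
  have hdegG : (C P * X ^ n + C (P * Q - 1) : ℂ[X][X]).natDegree = n := by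
    rw [natDegree_add_C, natDegree_C_mul_X_pow n P hP]
  have hrev : (C P * X ^ n + C (P * Q - 1) : ℂ[X][X]).reverse
      = C (P * Q - 1) * X ^ n + C P := by
    rw [reverse, hdegG, reflect_add, reflect_C_mul_X_pow, reflect_C, revAt_le le_rfl]
    simp [add_comm]
  have hdegH : (C (P * Q - 1) * X ^ n + C P : ℂ[X][X]).natDegree = n := by
    rw [natDegree_add_C, natDegree_C_mul_X_pow n _ hQ]
  have hcoefn : (C (P * Q - 1) * X ^ n + C P : ℂ[X][X]).coeff n = P * Q - 1 := by
    rw [coeff_add, coeff_C_mul, coeff_X_pow, if_pos rfl, coeff_C, if_neg hn.ne', mul_one, add_zero]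
  have hcoef0 : (C (P * Q - 1) * X ^ n + C P : ℂ[X][X]).coeff 0 = P := by
    simp [coeff_X_pow, hn.ne]
  apply aux_irreducible_of_reverse
  · rw [coeff_add, coeff_C_mul, coeff_X_pow, if_neg hn.ne, coeff_C_zero]
    simpa using hQ
  rw [hrev]
  apply irreducible_of_eisenstein_criterion (P := Ideal.span {X - C r})
  · rw [Ideal.span_singleton_prime (X_sub_C_ne_zero r)]
    exact prime_X_sub_C r
  · rw [leadingCoeff, hdegH, hcoefn, Ideal.mem_span_singleton, dvd_iff_isRoot]
    exact hQr
  · intro k hk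
    have hk' : k < n := by
      rw [← hdegH]; exact coe_lt_degree.mp hk
    rw [Ideal.mem_span_singleton, coeff_add, coeff_C_mul, coeff_X_pow, if_neg hk'.ne, mul_zero,
      zero_add, coeff_C]
    split_ifs
    · exact dvd_iff_isRoot.mpr hr
    · exact dvd_zero _
  · rw [← natDegree_pos_iff_degree_pos, hdegH]; exact hn
  · rw [hcoef0, Ideal.span_singleton_pow, Ideal.mem_span_singleton]
    rintro ⟨q, rfl⟩
    apply hd
    simp [derivative_mul, derivative_pow]
  · rw [isPrimitive_iff_isUnit_of_C_dvd]
    intro c hc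
    rw [C_dvd_iff_dvd_coeff] at hc
    have h1 := hc n
    have h2 := hc 0
    rw [hcoefn] at h1
    rw [hcoef0] at h2
    rw [isUnit_iff_dvd_one]
    have := dvd_sub (h2.mul_right Q) h1
    simpa using this

lemma aux_sigma (s : ℕ → ℂ[X]) (h0 : s 0 = 0) (h1 : s 1 = 1)
    (hs : ∀ n, s (n + 2) = X * s (n + 1) - s n) (n : ℕ) :
    (s (n + 1)).Monic ∧ (s (n + 1)).natDegree = n ∧ (s n).degree < n ∧
    s (n + 1) ^ 2 - X * s (n + 1) * s n + s n ^ 2 = 1 ∧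
    (X ^ 2 - 4) * derivative (s n) = ((n : ℂ[X]) - 1) * X * s n - 2 * (n : ℂ[X]) * (X * s n - s (n + 1)) ∧
    (X ^ 2 - 4) * derivative (s (n + 1)) = (n : ℂ[X]) * X * s (n + 1) - 2 * ((n : ℂ[X]) + 1) * s n := by
  induction n with
  | zero => simp [h0, h1]
  | succ n ih =>
    obtain ⟨hm, hd, hl, hq, hD, hD'⟩ := ih
    have hdeg : (s (n + 1)).degree = n := by rw [degree_eq_natDegree hm.ne_zero, hd]
    have hXd : (X * s (n + 1)).degree = ((n + 1 : ℕ) : WithBot ℕ) := by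
      rw [degree_mul, degree_X, hdeg]; push_cast; ring
    have hlt : (s n).degree < (X * s (n + 1)).degree := by
      rw [hXd]; refine hl.trans ?_; exact_mod_cast Nat.lt_succ_self n
    have hd2 : (s (n + 2)).degree = ((n + 1 : ℕ) : WithBot ℕ) := by
      rw [hs, degree_sub_eq_left_of_degree_lt hlt, hXd]
    refine ⟨?_, natDegree_eq_of_degree_eq_some hd2, ?_, ?_, ?_, ?_⟩
    · show (s (n + 2)).Monic
      rw [hs]; exact (monic_X.mul hm).sub_of_left hlt
    · rw [hdeg]; exact_mod_cast Nat.lt_succ_self n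
    · show s (n + 2) ^ 2 - X * s (n + 2) * s (n + 1) + s (n + 1) ^ 2 = 1
      rw [hs]; linear_combination hq
    · show _ = _ - _ * (_ - s (n + 2))
      rw [hs]; push_cast; linear_combination hD'
    · show (X ^ 2 - 4) * derivative (s (n + 2)) = _ * s (n + 2) - _
      rw [hs, derivative_sub, derivative_mul, derivative_X]
      push_cast
      linear_combination X * hD' - hD

theorem stmt14
    (σ : ℤ → Polynomial ℤ)
    (hσ0 : σ 0 = 0) (hσ1 : σ 1 = 1)
    (hσ : ∀ i : ℤ, σ (i + 1) = X * σ i - σ (i - 1))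
    (Φ : ℤ → Polynomial ℤ)
    (hΦeven : ∀ i : ℤ, Φ (2 * i) = σ i)
    (hΦodd : ∀ i : ℤ, Φ (2 * i - 1) = σ i - σ (i - 1))
    (t : ℕ) (ht3 : 3 ≤ t) (htodd : Odd t)
    (f : Polynomial (Polynomial ℤ))
    (hf : f = ((Φ t).map (Int.castRingHom (Polynomial ℤ)))
            * ((Φ (-(t : ℤ) - 1)).map (Int.castRingHom (Polynomial ℤ)))
            * (C (X ^ 2 - 2) - X) - 1)
    (m : ℕ) (hm : 0 < m) :
    Irreducible
      ((f.map ((aeval ((X : Polynomial ℤ) ^ m)).toRingHom : Polynomial ℤ →+* Polynomial ℤ)).map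
        (Polynomial.mapRingHom (Int.castRingHom ℂ))) := by
  obtain ⟨j, rfl⟩ := htodd
  obtain ⟨k, rfl⟩ : ∃ k, j = k + 1 := ⟨j - 1, by omega⟩
  -- symmetry of `σ`
  have hneg : ∀ n : ℕ, σ (-(n : ℤ)) = -σ n ∧ σ (-((n : ℤ) + 1)) = -σ (n + 1) := by
    intro n
    induction n with
    | zero =>
      have := hσ 0
      simp only [zero_add, hσ0, hσ1, zero_sub] at this
      simp only [Nat.cast_zero, neg_zero, hσ0, zero_add, hσ1, true_and]
      linear_combination this
    | succ n ih =>
      obtain ⟨ha, hb⟩ := ih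
      refine ⟨by exact_mod_cast hb, ?_⟩
      have h1 := hσ (-((n : ℤ) + 1))
      have h2 := hσ ((n : ℤ) + 1)
      rw [show -((n : ℤ) + 1) + 1 = -n by ring,
        show -((n : ℤ) + 1) - 1 = -(n + 1 + 1) by ring, ha, hb] at h1
      rw [show (n : ℤ) + 1 - 1 = n by ring] at h2
      push_cast
      linear_combination h1 + h2
  set s : ℕ → ℂ[X] := fun n => (σ n).map (Int.castRingHom ℂ) with hsdef
  have hs0 : s 0 = 0 := by simp [hsdef, hσ0]
  have hs1 : s 1 = 1 := by simp [hsdef, hσ1]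
  have hs : ∀ n, s (n + 2) = X * s (n + 1) - s n := by
    intro n
    have := hσ (n + 1)
    rw [show (n : ℤ) + 1 - 1 = n by ring] at this
    simp only [hsdef]
    push_cast
    rw [show (n : ℤ) + 2 = n + 1 + 1 by ring, this]
    simp
  obtain ⟨hmon, hdeg, -, hq, -, hD⟩ := aux_sigma s hs0 hs1 hs (k + 1)
  obtain ⟨r, hr⟩ := Complex.exists_root (f := s (k + 1 + 1)) (by
    rw [← natDegree_pos_iff_degree_pos, hdeg]; omega)
  have hr' : (s (k + 1 + 1)).eval r = 0 := hr
  have hq' := congrArg (eval r) hq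
  have hD' := congrArg (eval r) hD
  simp [hr'] at hq' hD'
  have hsk : (s (k + 1)).eval r ≠ 0 := by
    rcases hq' with h | h <;> rw [h] <;> simp
  have hder : (derivative (s (k + 1 + 1))).eval r ≠ 0 := by
    intro h
    rw [h, mul_zero] at hD'
    have h3 : ((k : ℂ) + 1 + 1) ≠ 0 := by
      exact_mod_cast Nat.succ_ne_zero (k + 1)
    simp [h3, hsk] at hD'
  set P : ℂ[X] := -((s (k + 1 + 1) - s (k + 1)) * s (k + 1 + 1)) with hP
  have main := aux_eisenstein P r (by simp [hP, hr'])
    (by simp [hP, hr', hsk, hder]) (-(X + 2)) (2 * m) (by omega)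
  have e1 : Φ ((2 * (k + 1) + 1 : ℕ) : ℤ) = σ (k + 1 + 1) - σ (k + 1) := by
    have := hΦodd (k + 1 + 1)
    rw [show (k : ℤ) + 1 + 1 - 1 = k + 1 by ring] at this
    rw [← this]; congr 1; push_cast; ring
  have e2 : Φ (-((2 * (k + 1) + 1 : ℕ) : ℤ) - 1) = -σ (k + 1 + 1) := by
    have := hΦeven (-(k + 1 + 1))
    have h2 := (hneg (k + 1)).2
    push_cast at h2
    rw [h2] at this
    rw [← this]; congr 1
  rw [e1, e2] at hf
  rw [← MulEquiv.irreducible_iff (Bivariate.swap (R := ℂ))]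
  convert main using 1
  have hmm : ∀ p : ℤ[X], ((p.map (Int.castRingHom ℤ[X])).map
      ((aeval ((X : Polynomial ℤ) ^ m)).toRingHom : Polynomial ℤ →+* Polynomial ℤ)).map
        (Polynomial.mapRingHom (Int.castRingHom ℂ)) = (p.map (Int.castRingHom ℂ)).map C := by
    intro p
    rw [map_map, map_map, map_map]
    congr 1
    exact RingHom.ext_int _ _
  have e3 : (σ ((k : ℤ) + 1 + 1)).map (Int.castRingHom ℂ) = s (k + 1 + 1) := by
    simp [hsdef]
  have e4 : (σ ((k : ℤ) + 1)).map (Int.castRingHom ℂ) = s (k + 1) := by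
    simp [hsdef]
  rw [hf, Polynomial.map_sub, Polynomial.map_sub, Polynomial.map_mul, Polynomial.map_mul,
    Polynomial.map_mul, Polynomial.map_mul, hmm, hmm, Polynomial.map_sub, Polynomial.map_neg,
    e3, e4, map_sub, map_mul, map_mul, Bivariate.swap_map_C, Bivariate.swap_map_C]
  have e5 : Bivariate.swap (R := ℂ) (((C (X ^ 2 - 2) - X : ℤ[X][X]).map
      ((aeval ((X : Polynomial ℤ) ^ m)).toRingHom : Polynomial ℤ →+* Polynomial ℤ)).map
        (Polynomial.mapRingHom (Int.castRingHom ℂ))) = X ^ (2 * m) - 2 - C X := by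
    have e6 : (((C (X ^ 2 - 2) - X : ℤ[X][X]).map
      ((aeval ((X : Polynomial ℤ) ^ m)).toRingHom : Polynomial ℤ →+* Polynomial ℤ)).map
        (Polynomial.mapRingHom (Int.castRingHom ℂ))) = (C X) ^ (2 * m) - 2 - X := by
      simp [← pow_mul, mul_comm]
      rw [map_ofNat, Polynomial.map_ofNat, map_ofNat]
    rw [e6, map_sub, map_sub, map_pow, Bivariate.swap_X, Bivariate.swap_Y, map_ofNat]
  rw [e5, hP]
  simp only [Polynomial.map_one, map_one, map_sub, map_neg, map_mul, map_add, map_ofNat]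
  ring
end

section
/- Let t ≥ 3 be an odd integer and let ℚ^{ab} denote the subfield of ℂ generated by all roots of unity. Then for all but finitely many positive integers n, the one-variable polynomial f_t(X, ζ_n + ζ_n⁻¹) ∈ ℚ^{ab}[X], obtained by substituting Z = ζ_n + ζ_n⁻¹ = 2cos(2π/n) into f_t, is irreducible over ℚ^{ab}. -/
open Polynomial Complex


/-- degree data: monic of degree `d` in the `X`-variable, with `L`-th coefficient leading. -/
def Shape (G : ℂ[X][X]) (L d : ℕ) : Prop :=
  (G.coeff L).Monic ∧ (G.coeff L).natDegree = d ∧ ∀ i, i ≠ L → (G.coeff i).degree < d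

lemma Shape.top {G G' : ℂ[X][X]} {L d d' k : ℕ} {Q : ℂ[X]} (h : Shape G L d) (h' : Shape G' L d')
    (hdeg : (G * G').natDegree = 2 * L + k) (hlc : (G * G').leadingCoeff = Q) (hQ : Q ≠ 0)
    (hQd : Q.natDegree + 1 = d + d') :
    (G.natDegree = L ∧ G'.natDegree = L + k) ∨ (G.natDegree = L + k ∧ G'.natDegree = L) := by
  have hG : G ≠ 0 := by rintro rfl; simp [Shape] at h
  have hG' : G' ≠ 0 := by rintro rfl; simp [Shape] at h'
  rw [natDegree_mul hG hG'] at hdeg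
  rw [leadingCoeff_mul] at hlc
  have h1 : L ≤ G.natDegree := le_natDegree_of_ne_zero h.1.ne_zero
  have h2 : L ≤ G'.natDegree := le_natDegree_of_ne_zero h'.1.ne_zero
  by_cases e1 : G.natDegree = L
  · left; omega
  by_cases e2 : G'.natDegree = L
  · right; omega
  exfalso
  have a1 := h.2.2 _ e1
  have a2 := h'.2.2 _ e2
  have n1 : G.coeff G.natDegree ≠ 0 := leadingCoeff_ne_zero.2 hG
  have n2 : G'.coeff G'.natDegree ≠ 0 := leadingCoeff_ne_zero.2 hG'
  rw [degree_eq_natDegree n1] at a1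
  rw [degree_eq_natDegree n2] at a2
  have : Q.natDegree = (G.coeff G.natDegree).natDegree + (G'.coeff G'.natDegree).natDegree := by
    rw [← hlc]; exact natDegree_mul n1 n2
  norm_cast at a1 a2
  omega

lemma Shape.bot {G G' : ℂ[X][X]} {L d d' k : ℕ} {Q : ℂ[X]} (h : Shape G L d) (h' : Shape G' L d')
    (hk : k ≤ 2 * L)
    (hdeg : (G * G').natTrailingDegree = 2 * L - k) (hlc : (G * G').trailingCoeff = Q) (hQ : Q ≠ 0)
    (hQd : Q.natDegree + 1 = d + d') :
    (G.natTrailingDegree = L ∧ G'.natTrailingDegree + k = L) ∨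
    (G.natTrailingDegree + k = L ∧ G'.natTrailingDegree = L) := by
  have hG : G ≠ 0 := by rintro rfl; simp [Shape] at h
  have hG' : G' ≠ 0 := by rintro rfl; simp [Shape] at h'
  rw [natTrailingDegree_mul hG hG'] at hdeg
  rw [trailingCoeff_mul] at hlc
  have h1 : G.natTrailingDegree ≤ L := natTrailingDegree_le_of_ne_zero h.1.ne_zero
  have h2 : G'.natTrailingDegree ≤ L := natTrailingDegree_le_of_ne_zero h'.1.ne_zero
  by_cases e1 : G.natTrailingDegree = L
  · left; omega
  by_cases e2 : G'.natTrailingDegree = L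
  · right; omega
  exfalso
  have a1 := h.2.2 _ e1
  have a2 := h'.2.2 _ e2
  have n1 : G.coeff G.natTrailingDegree ≠ 0 := trailingCoeff_nonzero_iff_nonzero.2 hG
  have n2 : G'.coeff G'.natTrailingDegree ≠ 0 := trailingCoeff_nonzero_iff_nonzero.2 hG'
  rw [degree_eq_natDegree n1] at a1
  rw [degree_eq_natDegree n2] at a2
  have : Q.natDegree = (G.coeff G.natTrailingDegree).natDegree
      + (G'.coeff G'.natTrailingDegree).natDegree := by
    rw [← hlc]; exact natDegree_mul n1 n2
  norm_cast at a1 a2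
  omega

lemma Shape.const_of {G : ℂ[X][X]} {L : ℕ} (h1 : G.natDegree = L) (h2 : G.natTrailingDegree = L) :
    ∀ i, i ≠ L → G.coeff i = 0 := by
  intro i hi
  rcases lt_or_gt_of_ne hi with h | h
  · exact coeff_eq_zero_of_lt_natTrailingDegree (by omega)
  · exact coeff_eq_zero_of_natDegree_lt (by omega)

/-- the target polynomial -/
noncomputable def target (P : ℂ[X]) (L : ℕ) (r : ℤ) (u v : ℂ) : ℂ[X][X] :=
  C (P * X - 1) * X ^ (2 * L) - C (C u * P) * X ^ ((2 * L + r).toNat)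
    - C (C v * P) * X ^ ((2 * L - r).toNat)

lemma ff_const {P g A B : ℂ[X]} {u : ℂ} (hu : u ≠ 0) (hg : g.natDegree ≠ 0)
    (h1 : g * A = -(C u * P)) (h2 : g * B = P * X - 1) : False := by
  have : g ∣ P := by
    have : g ∣ C u * P := ⟨-A, by rw [mul_neg, h1]; ring⟩
    have h3 : g ∣ C u⁻¹ * (C u * P) := Dvd.dvd.mul_left this _
    rwa [← mul_assoc, ← C_mul, inv_mul_cancel₀ hu, C_1, one_mul] at h3
  have h4 : g ∣ 1 := by
    have : (1 : ℂ[X]) = P * X - g * B := by rw [h2]; ring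
    rw [this]
    exact dvd_sub (Dvd.dvd.mul_right ‹_› _) (Dvd.intro _ rfl)
  exact hg (natDegree_eq_zero_of_isUnit (isUnit_of_dvd_one h4))

lemma target_coeff (P : ℂ[X]) (L k : ℕ) (hk : 0 < k) (hkL : k ≤ 2 * L) (u v : ℂ) (i : ℕ) :
    (target P L k u v).coeff i = if i = 2 * L then P * X - 1 else
      if i = 2 * L + k then -(C u * P) else if i = 2 * L - k then -(C v * P) else 0 := by
  have e1 : (2 * (L : ℤ) + k).toNat = 2 * L + k := by omega
  have e2 : (2 * (L : ℤ) - k).toNat = 2 * L - k := by omega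
  simp only [target, e1, e2, coeff_sub, coeff_C_mul, coeff_X_pow]
  split_ifs <;> first | omega | simp

lemma target_top (P : ℂ[X]) (hP : P ≠ 0) (L k : ℕ) (hk : 0 < k) (hkL : k ≤ 2 * L) (u v : ℂ)
    (hu : u ≠ 0) :
    (target P L k u v).natDegree = 2 * L + k ∧
    (target P L k u v).leadingCoeff = -(C u * P) := by
  have h1 : (target P L k u v).natDegree = 2 * L + k := by
    apply natDegree_eq_of_le_of_coeff_ne_zero
    · rw [natDegree_le_iff_coeff_eq_zero]
      intro N hN
      rw [target_coeff P L k hk hkL]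
      split_ifs <;> first | omega | rfl
    · rw [target_coeff P L k hk hkL]
      split_ifs <;> first | omega | simp [hu, hP]
  refine ⟨h1, ?_⟩
  rw [leadingCoeff, h1, target_coeff P L k hk hkL]
  split_ifs <;> first | omega | rfl

lemma target_bot (P : ℂ[X]) (hP : P ≠ 0) (L k : ℕ) (hk : 0 < k) (hkL : k ≤ 2 * L) (u v : ℂ)
    (hv : v ≠ 0) :
    (target P L k u v).natTrailingDegree = 2 * L - k ∧
    (target P L k u v).trailingCoeff = -(C v * P) := by
  have h0 : (target P L k u v).coeff (2 * L - k) = -(C v * P) := by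
    rw [target_coeff P L k hk hkL]
    split_ifs <;> first | omega | rfl
  have hne : -(C v * P) ≠ 0 := by simp [hv, hP]
  have h1 : (target P L k u v).natTrailingDegree = 2 * L - k := by
    apply le_antisymm
    · apply natTrailingDegree_le_of_ne_zero; rwa [h0]
    · apply le_natTrailingDegree
      · intro h; rw [h] at h0; simp at h0; simp [hv,hP] at h0
      · intro m hm
        rw [target_coeff P L k hk hkL]
        split_ifs <;> first | omega | rfl
  exact ⟨h1, by rw [trailingCoeff, h1, h0]⟩

lemma monomial_of_mul {a b : ℂ[X]} {n : ℕ} (h : a * b = -X ^ n) :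
    ∃ i j, i + j = n ∧ ∃ c c' : ℂ, c ≠ 0 ∧ c' ≠ 0 ∧ a = C c * X ^ i ∧ b = C c' * X ^ j := by
  have aux : ∀ a b : ℂ[X], a * b = -X ^ n → ∃ i, ∃ c : ℂ, c ≠ 0 ∧ a = C c * X ^ i := by
    intro a b h
    have : a ∣ X ^ n := ⟨-b, by rw [mul_neg, h]; ring⟩
    obtain ⟨i, -, u, hu⟩ := (dvd_prime_pow prime_X n).1 this
    obtain ⟨c, hc, hc'⟩ := Polynomial.isUnit_iff.1 (u⁻¹).isUnit
    refine ⟨i, c, hc.ne_zero, ?_⟩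
    rw [hc', ← hu, mul_comm, mul_assoc]
    simp
  obtain ⟨i, c, hc, ha⟩ := aux a b h
  obtain ⟨j, c', hc', hb⟩ := aux b a (by rw [mul_comm, h])
  refine ⟨i, j, ?_, c, c', hc, hc', ha, hb⟩
  have := congrArg natDegree h
  rw [ha, hb, natDegree_neg, natDegree_X_pow, natDegree_mul (by simp [hc]) (by simp [hc'])] at this
  simpa [natDegree_C_mul_X_pow _ _ hc, natDegree_C_mul_X_pow _ _ hc'] using this

/-- mixed case -/
lemma ff_mixed {P : ℂ[X]} (hP : P.Monic) (hsep : P.roots.Nodup) (heven : Even P.natDegree)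
    {L k : ℕ} (hk : 0 < k) (hkL : k ≤ 2 * L) {u v : ℂ} (hu : u ≠ 0) (hv : v ≠ 0)
    {G G' : ℂ[X][X]} {d d' : ℕ} (hG : Shape G L d) (hG' : Shape G' L d')
    (hprod : G * G' = target P L k u v) (hd : P.natDegree + 1 = d + d')
    (hkL' : G.natTrailingDegree + k = L)
    (t1 : G.natDegree = L) (t2 : G'.natDegree = L + k) (t4 : G'.natTrailingDegree = L) : False := by
  obtain ⟨tt1, tt2⟩ := target_top P hP.ne_zero L k hk hkL u v hu
  obtain ⟨tb1, tb2⟩ := target_bot P hP.ne_zero L k hk hkL u v hv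
  rw [← hprod, leadingCoeff_mul] at tt2
  rw [← hprod, trailingCoeff_mul] at tb2
  simp only [leadingCoeff, trailingCoeff, t1, t2, t4] at tt2 tb2
  have t3 : G.natTrailingDegree = L - k := by omega
  rw [t3] at tb2
  set H := G.coeff L with hH
  set W := G.coeff (L - k) with hW
  have hWd : W.natDegree + 1 = d := by
    have h0 : W * G'.coeff L ≠ 0 := by rw [tb2]; simp [hv, hP.ne_zero]
    have := congrArg natDegree tb2
    rw [natDegree_neg, natDegree_C_mul hv, natDegree_mul (left_ne_zero_of_mul h0)
      (right_ne_zero_of_mul h0), hG'.2.1] at this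
    omega
  have key : ∀ r, P.IsRoot r → (H.eval r = 0 ↔ W.eval r ≠ 0) := by
    intro r hr
    have hr0 : P.eval r = 0 := hr
    have e := congrArg (Polynomial.map (evalRingHom r)) hprod
    have e' : (target P L k u v).map (evalRingHom r) = - X ^ (2 * L) := by
      simp [target, hr0]
    rw [Polynomial.map_mul, e'] at e
    obtain ⟨i, j, hij, c, c', hc, hc', ha, hb⟩ := monomial_of_mul e
    have cH : H.eval r = (C c * X ^ i : ℂ[X]).coeff L := by rw [← ha]; simp [hH]
    have cW : W.eval r = (C c * X ^ i : ℂ[X]).coeff (L - k) := by rw [← ha]; simp [hW]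
    have cH' : (G'.coeff (L+k)).eval r = (C c' * X ^ j : ℂ[X]).coeff (L + k) := by
      rw [← hb]; simp
    simp only [coeff_C_mul, coeff_X_pow] at cH cW cH'
    constructor
    · intro h0
      have hnz : (G'.coeff (L+k)).eval r ≠ 0 := by
        intro h1
        have hPP : P = C (-u⁻¹) * (H * G'.coeff (L + k)) := by
          rw [tt2, mul_neg, ← mul_assoc, ← C_mul, neg_mul, inv_mul_cancel₀ hu]; simp
        obtain ⟨A, hA⟩ := dvd_iff_isRoot.2 (show H.IsRoot r from h0)
        obtain ⟨B, hB⟩ := dvd_iff_isRoot.2 (show (G'.coeff (L+k)).IsRoot r from h1)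
        have hdvd : (X - C r) ^ 2 ∣ P := by
          rw [hPP, hA, hB]; exact ⟨C (-u⁻¹) * (A * B), by ring⟩
        have := (le_rootMultiplicity_iff hP.ne_zero).2 hdvd
        rw [← count_roots] at this
        have := Multiset.nodup_iff_count_le_one.1 hsep r
        omega
      rw [cH'] at hnz
      have hj : L + k = j := by
        by_contra hne; simp [hne] at hnz
      rw [cW, if_pos (by omega)]; simpa using hc
    · intro h1
      rw [cW] at h1
      have hj : L - k = i := by
        by_contra hne; simp [hne] at h1
      rw [cH, if_neg (by omega)]; simp
  have hHP : H ∣ P := by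
    have : H ∣ C u * P := ⟨-G'.coeff (L+k), by rw [mul_neg, tt2]; ring⟩
    have h3 : H ∣ C u⁻¹ * (C u * P) := Dvd.dvd.mul_left this _
    rwa [← mul_assoc, ← C_mul, inv_mul_cancel₀ hu, C_1, one_mul] at h3
  have hWP : W ∣ P := by
    have : W ∣ C v * P := ⟨-G'.coeff L, by rw [mul_neg, tb2]; ring⟩
    have h3 : W ∣ C v⁻¹ * (C v * P) := Dvd.dvd.mul_left this _
    rwa [← mul_assoc, ← C_mul, inv_mul_cancel₀ hv, C_1, one_mul] at h3
  have hW0 : W ≠ 0 := ne_zero_of_dvd_ne_zero hP.ne_zero hWP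
  have hH0 : H ≠ 0 := hG.1.ne_zero
  have hroots : P.roots = H.roots + W.roots := by
    have n1 : H.roots.Nodup := Multiset.nodup_of_le (Polynomial.roots.le_of_dvd hP.ne_zero hHP) hsep
    have n2 : W.roots.Nodup := Multiset.nodup_of_le (Polynomial.roots.le_of_dvd hP.ne_zero hWP) hsep
    have dis : Disjoint H.roots W.roots := by
      rw [Multiset.disjoint_left]
      intro a ha hb
      rw [mem_roots hH0] at ha; rw [mem_roots hW0] at hb
      exact (key a (ha.dvd hHP)).1 ha hb
    refine (Multiset.Nodup.ext hsep ((Multiset.nodup_add).2 ⟨n1, n2, dis⟩)).2 ?_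
    intro a
    rw [Multiset.mem_add, mem_roots hP.ne_zero, mem_roots hH0, mem_roots hW0]
    constructor
    · intro ha
      by_cases h : H.eval a = 0
      · exact Or.inl h
      · right; by_contra h2; exact h ((key a ha).2 h2)
    · rintro (h | h)
      · exact h.dvd hHP
      · exact h.dvd hWP
  have := congrArg Multiset.card hroots
  rw [Multiset.card_add, ← (IsAlgClosed.splits P).natDegree_eq_card_roots,
    ← (IsAlgClosed.splits H).natDegree_eq_card_roots,
    ← (IsAlgClosed.splits W).natDegree_eq_card_roots] at this
  have hHd : H.natDegree = d := hG.2.1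
  obtain ⟨z, hz⟩ := heven
  omega

lemma ff_main_pos {P : ℂ[X]} (hP : P.Monic) (hsep : P.roots.Nodup) (heven : Even P.natDegree)
    {L k : ℕ} (hk : 0 < k) (hkL : k ≤ 2 * L) {u v : ℂ} (hu : u ≠ 0) (hv : v ≠ 0)
    {G G' : ℂ[X][X]} {d d' : ℕ} (hG : Shape G L d) (hG' : Shape G' L d')
    (hprod : G * G' = target P L k u v) (hd : P.natDegree + 1 = d + d')
    (hd0 : 0 < d) (hd0' : 0 < d') : False := by
  obtain ⟨tt1, tt2⟩ := target_top P hP.ne_zero L k hk hkL u v hu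
  obtain ⟨tb1, tb2⟩ := target_bot P hP.ne_zero L k hk hkL u v hv
  have hT := Shape.top hG hG' (hprod ▸ tt1) (hprod ▸ tt2) (by simp [hu, hP.ne_zero])
    (by rw [natDegree_neg, natDegree_C_mul hu, hd])
  have hB := Shape.bot hG hG' hkL (hprod ▸ tb1) (hprod ▸ tb2) (by simp [hv, hP.ne_zero])
    (by rw [natDegree_neg, natDegree_C_mul hv, hd])
  -- constant case
  have hconst : ∀ {G G' : ℂ[X][X]} {d : ℕ}, Shape G L d → 0 < d → G * G' = target P L k u v →
      G.natDegree = L → G.natTrailingDegree = L → False := by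
    intro G G' d hG hd0 hprod a b
    have hc := Shape.const_of a b
    have hGe : G = C (G.coeff L) * X ^ L := by
      ext1 i
      rw [coeff_C_mul, coeff_X_pow]
      split_ifs with h
      · rw [h]; simp
      · rw [hc i h]; simp
    have hm : ∀ i, G.coeff L * G'.coeff i = (target P L k u v).coeff (i + L) := by
      intro i
      conv_rhs => rw [← hprod, hGe]
      rw [mul_assoc, coeff_C_mul, mul_comm (X ^ L) G', coeff_mul_X_pow]
    have h1 := hm (L + k)
    have h2 := hm L
    rw [target_coeff P L k hk hkL, if_neg (by omega), if_pos (by omega)] at h1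
    rw [target_coeff P L k hk hkL, if_pos (by omega)] at h2
    exact ff_const hu (by rw [hG.2.1]; omega) h1 h2
  have hprod' : G' * G = target P L k u v := by rw [mul_comm, hprod]
  rcases hT with ⟨a, b⟩ | ⟨a, b⟩ <;> rcases hB with ⟨a', b'⟩ | ⟨a', b'⟩
  · exact hconst hG hd0 hprod a a'
  · exact ff_mixed hP hsep heven hk hkL hu hv hG hG' hprod hd a' a b b'
  · exact ff_mixed hP hsep heven hk hkL hu hv hG' hG hprod' (by omega) b' b a a'
  · exact hconst hG' hd0' hprod' b b'

lemma ff_main {P : ℂ[X]} (hP : P.Monic) (hsep : P.roots.Nodup) (heven : Even P.natDegree)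
    {L : ℕ} {r : ℤ} (hr : r ≠ 0) (hrL : |r| ≤ 2 * L) {u v : ℂ} (hu : u ≠ 0) (hv : v ≠ 0)
    {G G' : ℂ[X][X]} {d d' : ℕ} (hG : Shape G L d) (hG' : Shape G' L d')
    (hprod : G * G' = target P L r u v) (hd : P.natDegree + 1 = d + d')
    (hd0 : 0 < d) (hd0' : 0 < d') : False := by
  rw [abs_le] at hrL
  rcases lt_or_gt_of_ne hr with h | h
  · obtain ⟨k, hk⟩ : ∃ k : ℕ, (k : ℤ) = -r := ⟨(-r).toNat, by omega⟩
    have : target P L r u v = target P L k v u := by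
      rw [target, target, hk]
      simp only [sub_neg_eq_add, ← sub_eq_add_neg]; ring
    exact ff_main_pos hP hsep heven (k := k) (by omega) (by omega) hv hu hG hG'
      (this ▸ hprod) hd hd0 hd0'
  · obtain ⟨k, hk⟩ : ∃ k : ℕ, (k : ℤ) = r := ⟨r.toNat, by omega⟩
    exact ff_main_pos hP hsep heven (k := k) (by omega) (by omega) hu hv hG hG'
      (hk ▸ hprod) hd hd0 hd0'

lemma ff_zero {L : ℕ} {F : ℂ[X]} (hF : F ≠ 0)
    {G G' : ℂ[X][X]} {d d' : ℕ} (hG : Shape G L d) (hG' : Shape G' L d')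
    (hprod : G * G' = C F * X ^ (2 * L)) :
    G = C (G.coeff L) * X ^ L ∧ G' = C (G'.coeff L) * X ^ L := by
  have g0 : G ≠ 0 := by rintro rfl; simp [Shape] at hG
  have g0' : G' ≠ 0 := by rintro rfl; simp [Shape] at hG'
  have h1 : L ≤ G.natDegree := le_natDegree_of_ne_zero hG.1.ne_zero
  have h2 : L ≤ G'.natDegree := le_natDegree_of_ne_zero hG'.1.ne_zero
  have h3 : G.natTrailingDegree ≤ L := natTrailingDegree_le_of_ne_zero hG.1.ne_zero
  have h4 : G'.natTrailingDegree ≤ L := natTrailingDegree_le_of_ne_zero hG'.1.ne_zero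
  have e1 := congrArg natDegree hprod
  have e2 := congrArg natTrailingDegree hprod
  have hFm : C F * X ^ (2 * L) = monomial (2 * L) F := C_mul_X_pow_eq_monomial
  rw [natDegree_mul g0 g0', natDegree_C_mul_X_pow _ _ hF] at e1
  rw [natTrailingDegree_mul g0 g0', hFm, natTrailingDegree_monomial hF] at e2
  have aux : ∀ G : ℂ[X][X], (∀ i, i ≠ L → G.coeff i = 0) → G = C (G.coeff L) * X ^ L := by
    intro G hc
    ext1 i
    rw [coeff_C_mul, coeff_X_pow]
    split_ifs with h
    · rw [h]; simp
    · rw [hc i h]; simp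
  exact ⟨aux G (Shape.const_of (by omega) (by omega)), aux G' (Shape.const_of (by omega) (by omega))⟩


noncomputable def spec (γ : ℕ → ℂ) (d : ℕ) : ℂ[X] :=
  X ^ d + ∑ a ∈ Finset.range d, C (γ a) * X ^ a

lemma spec_deg_lt (γ : ℕ → ℂ) (d : ℕ) :
    (∑ a ∈ Finset.range d, C (γ a) * X ^ a : ℂ[X]).degree < d := by
  rw [degree_lt_iff_coeff_zero]
  intro m hm
  simp only [finsetSum_coeff, coeff_C_mul, coeff_X_pow]
  apply Finset.sum_eq_zero
  intro a ha
  rw [if_neg (by have := Finset.mem_range.1 ha; omega)]; simp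

lemma spec_monic (γ : ℕ → ℂ) (d : ℕ) : (spec γ d).Monic := monic_X_pow_add (spec_deg_lt γ d)

lemma spec_natDegree (γ : ℕ → ℂ) (d : ℕ) : (spec γ d).natDegree = d := by
  rw [spec, natDegree_add_eq_left_of_degree_lt] <;> simp [spec_deg_lt]

lemma spec_coeff (γ : ℕ → ℂ) (d a : ℕ) (ha : a < d) : (spec γ d).coeff a = γ a := by
  simp [spec, coeff_X_pow, ha.ne, ha]

lemma spec_congr {γ γ' : ℕ → ℂ} {d : ℕ} (h : ∀ a < d, γ a = γ' a) : spec γ d = spec γ' d := by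
  rw [spec, spec]; congr 1
  exact Finset.sum_congr rfl fun a ha => by rw [h a (Finset.mem_range.1 ha)]

lemma spec_eq_of_monic {p : ℂ[X]} (hp : p.Monic) : p = spec p.coeff p.natDegree := by
  rw [spec]; exact hp.as_sum

lemma pigeon (S : Finset ℕ) (q : ℕ) (hq : 2 * 16 ^ S.card < q) :
    ∃ k, 0 < k ∧ k ≤ q / 2 ∧ ∃ r : ℕ → ℤ, ∀ i ∈ S, |r i| ≤ (q / 16 : ℕ) ∧ (q : ℤ) ∣ k * i - r i := by
  have hq0 : 0 < q := by omega
  let f : ℕ → (S → Fin 16) := fun k i => ⟨16 * (k * i % q) / q, by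
    rw [Nat.div_lt_iff_lt_mul hq0]
    have := Nat.mod_lt (k * i) hq0
    omega⟩
  obtain ⟨x, hx, y, hy, hxy, hf⟩ : ∃ x ∈ Finset.range (q / 2 + 1), ∃ y ∈ Finset.range (q / 2 + 1),
      x ≠ y ∧ f x = f y := by
    apply Finset.exists_ne_map_eq_of_card_lt_of_maps_to (t := Finset.univ)
    · simp; omega
    · intro _ _; simp
  have main : ∀ x ∈ Finset.range (q / 2 + 1), ∀ y ∈ Finset.range (q / 2 + 1), x < y → f x = f y →
    ∃ k, 0 < k ∧ k ≤ q / 2 ∧ ∃ r : ℕ → ℤ, ∀ i ∈ S, |r i| ≤ (q / 16 : ℕ) ∧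
      (q : ℤ) ∣ k * i - r i := by
    intro x hx y hy hxy hf
    rw [Finset.mem_range] at hx hy
    refine ⟨y - x, by omega, by omega, fun i => ((y * i % q : ℕ) : ℤ) - ((x * i % q : ℕ) : ℤ), ?_⟩
    intro i hi
    constructor
    · have h1 := congrFun hf ⟨i, hi⟩
      simp only [f, Fin.mk.injEq] at h1
      have a1 := Nat.div_add_mod (16 * (x * i % q)) q
      have a2 := Nat.div_add_mod (16 * (y * i % q)) q
      rw [h1] at a1
      have b1 := Nat.mod_lt (16 * (x * i % q)) hq0
      have b2 := Nat.mod_lt (16 * (y * i % q)) hq0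
      generalize q * (16 * (y * i % q) / q) = z at *
      show |((y * i % q : ℕ) : ℤ) - ((x * i % q : ℕ) : ℤ)| ≤ _
      rw [abs_le]
      omega
    · have a1 := Int.emod_add_mul_ediv ((x : ℤ) * i) q
      have a2 := Int.emod_add_mul_ediv ((y : ℤ) * i) q
      refine ⟨((y : ℤ) * i) / q - ((x : ℤ) * i) / q, ?_⟩
      push_cast [Nat.cast_sub hxy.le]
      linear_combination a1 - a2
  rcases lt_or_gt_of_ne hxy with h | h
  · exact main x hx y hy h hf
  · exact main y hy x hx h hf.symm

noncomputable def mkG (β : ℕ → ℕ → ℂ) (S : Finset ℕ) (r : ℕ → ℤ) (L d : ℕ) : ℂ[X][X] :=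
  monomial L (X ^ d) +
    ∑ i ∈ S, monomial ((L + r i).toNat) (∑ a ∈ Finset.range d, C (β a i) * X ^ a)

lemma mkG_sum_deg (β : ℕ → ℕ → ℂ) (S : Finset ℕ) (r : ℕ → ℤ) (L d j : ℕ) :
    ((∑ i ∈ S, monomial ((L + r i).toNat)
      (∑ a ∈ Finset.range d, C (β a i) * X ^ a : ℂ[X])).coeff j).degree < d := by
  rw [finsetSum_coeff]
  refine lt_of_le_of_lt (degree_sum_le _ _) ?_
  rw [Finset.sup_lt_iff (by exact WithBot.bot_lt_coe d)]
  intro i _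
  rw [coeff_monomial]
  split_ifs
  · exact spec_deg_lt (fun a => β a i) d
  · simp

lemma mkG_shape (β : ℕ → ℕ → ℂ) (S : Finset ℕ) (r : ℕ → ℤ) (L d : ℕ) :
    Shape (mkG β S r L d) L d := by
  have hs := mkG_sum_deg β S r L d
  refine ⟨?_, ?_, ?_⟩
  · rw [mkG, coeff_add, coeff_monomial, if_pos rfl]
    exact monic_X_pow_add (hs L)
  · rw [mkG, coeff_add, coeff_monomial, if_pos rfl, natDegree_add_eq_left_of_degree_lt]
    · simp
    · simpa using hs L
  · intro i hi
    rw [mkG, coeff_add, coeff_monomial, if_neg hi.symm, zero_add]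
    exact hs i

lemma mkG_natDegree (β : ℕ → ℕ → ℂ) (S : Finset ℕ) (r : ℕ → ℤ) (L d : ℕ)
    (hr : ∀ i ∈ S, |r i| ≤ L) : (mkG β S r L d).natDegree ≤ 2 * L := by
  rw [mkG]
  refine natDegree_add_le_of_degree_le ((natDegree_monomial_le _).trans (by omega)) ?_
  refine natDegree_sum_le_of_forall_le _ _ fun i hi => (natDegree_monomial_le _).trans ?_
  have := abs_le.1 (hr i hi)
  omega

lemma pow_toNat {η : ℂ} {q : ℕ} (hq : 0 < q) (hη : η ^ q = 1) {L k i c : ℕ} {r : ℤ}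
    (hr : |r| ≤ (L : ℤ)) (hd : (q : ℤ) ∣ k * i - r) (hc : (c : ℤ) = L + r) :
    η ^ c = η ^ L * (η ^ k) ^ i := by
  have h0 : η ≠ 0 := by rintro rfl; simp [hq.ne'] at hη
  obtain ⟨m, hm⟩ := hd
  rw [← zpow_natCast, ← pow_mul, ← pow_add, ← zpow_natCast]
  have : ((L + k * i : ℕ) : ℤ) = c + q * m := by push_cast; rw [hc]; linarith
  rw [this, zpow_add₀ h0, zpow_mul, zpow_natCast η q, hη, one_zpow, mul_one]

lemma mkG_eval (β : ℕ → ℕ → ℂ) (S : Finset ℕ) (r : ℕ → ℤ) (L d k q : ℕ) (hq : 0 < q)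
    (hr : ∀ i ∈ S, |r i| ≤ (L : ℤ) ∧ (q : ℤ) ∣ k * i - r i) (η : ℂ) (hη : η ^ q = 1) :
    (mkG β S r L d).eval (C η) = C (η ^ L) *
      spec (fun a => ∑ i ∈ S, β a i * (η ^ k) ^ i) d := by
  rw [mkG, spec, eval_add, eval_monomial, eval_finsetSum]
  simp only [eval_monomial]
  simp only [map_sum, Finset.sum_mul, mul_add, Finset.mul_sum]
  congr 1
  · rw [C_pow, mul_comm]
  · rw [Finset.sum_comm]
    refine Finset.sum_congr rfl fun a _ => Finset.sum_congr rfl fun i hi => ?_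
    obtain ⟨h1, h2⟩ := hr i hi
    have := abs_le.1 h1
    rw [← C_pow, pow_toNat hq hη (c := (L + r i).toNat) h1 h2 (by omega)]
    simp only [C_mul]; ring

lemma core {P : ℂ[X]} (hP : P.Monic) (hsep : P.roots.Nodup) (heven : Even P.natDegree)
    (q d d' e : ℕ) (hd : P.natDegree + 1 = d + d') (hd0 : 0 < d) (hd0' : 0 < d')
    (A B : ℂ → ℕ → ℂ) (J : Set ℂ) (hJ : ∀ η, η ^ q = 1 → η ≠ 1 → η ∈ J) (ω : ℂ) (hω : ω ≠ 0)
    (hfac : ∀ η ∈ J, η ^ q = 1 → spec (A η) d * spec (B η) d' =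
      P * (X - C (ω * η ^ e + (ω * η ^ e)⁻¹)) - 1)
    (S : Finset ℕ) (β β' : ℕ → ℕ → ℂ)
    (hA : ∀ η ∈ J, η ^ q = 1 → ∀ a < d, A η a = ∑ i ∈ S, β a i * η ^ i)
    (hB : ∀ η ∈ J, η ^ q = 1 → ∀ a < d', B η a = ∑ i ∈ S, β' a i * η ^ i)
    (hq : 2 * 16 ^ (S.card + 1) < q) :
    ∃ k, 0 < k ∧ k < q ∧ q ∣ k * e ∧ ∃ g g' : ℂ[X], ∀ η, η ^ q = 1 → η ^ k ∈ J →
      spec (A (η ^ k)) d = g ∧ spec (B (η ^ k)) d' = g' := by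
  have hq0 : 0 < q := by omega
  obtain ⟨k, hk0, hkq, r, hr⟩ := pigeon (insert e S) q (lt_of_le_of_lt (Nat.mul_le_mul_left _
    (Nat.pow_le_pow_right (by norm_num) (Finset.card_insert_le e S))) hq)
  set L := q / 16 with hL
  obtain ⟨hre1, hre2⟩ := hr e (Finset.mem_insert_self _ _)
  have hrS : ∀ i ∈ S, |r i| ≤ (L : ℤ) ∧ (q : ℤ) ∣ k * i - r i :=
    fun i hi => hr i (Finset.mem_insert_of_mem hi)
  set G := mkG β S r L d with hGdef
  set G' := mkG β' S r L d' with hGdef'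
  have evG : ∀ η, η ^ q = 1 → η ^ k ∈ J → G.eval (C η) = C (η ^ L) * spec (A (η ^ k)) d := by
    intro η h1 h2
    rw [hGdef, mkG_eval β S r L d k q hq0 hrS η h1]
    congr 1
    exact spec_congr fun a ha => (hA _ h2 (by rw [← pow_mul, mul_comm, pow_mul, h1, one_pow]) a ha).symm
  have evG' : ∀ η, η ^ q = 1 → η ^ k ∈ J → G'.eval (C η) = C (η ^ L) * spec (B (η ^ k)) d' := by
    intro η h1 h2
    rw [hGdef', mkG_eval β' S r L d' k q hq0 hrS η h1]
    congr 1
    exact spec_congr fun a ha => (hB _ h2 (by rw [← pow_mul, mul_comm, pow_mul, h1, one_pow]) a ha).symm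
  have hre := abs_le.1 hre1
  have hprod : G * G' = target P L (r e) ω ω⁻¹ := by
    rw [← sub_eq_zero]
    obtain ⟨η0, hη0⟩ : ∃ η0 : ℂ, IsPrimitiveRoot η0 q := ⟨_, Complex.isPrimitiveRoot_exp q hq0.ne'⟩
    let T : Finset ℂ := (nthRootsFinset q (1 : ℂ)) \ (nthRootsFinset k (1 : ℂ))
    have hT : ∀ η ∈ T, η ^ q = 1 ∧ η ^ k ≠ 1 := by
      intro η hη
      rw [Finset.mem_sdiff, mem_nthRootsFinset hq0, mem_nthRootsFinset hk0] at hη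
      exact hη
    have hTc : q - k ≤ T.card := by
      have h1 := Finset.le_card_sdiff (nthRootsFinset k (1 : ℂ)) (nthRootsFinset q (1 : ℂ))
      rw [hη0.card_nthRootsFinset, (Complex.isPrimitiveRoot_exp k hk0.ne').card_nthRootsFinset] at h1
      exact h1
    refine eq_zero_of_natDegree_lt_card_of_eval_eq_zero' _ (T.image C) ?_ ?_
    · intro x hx
      obtain ⟨η, hη, rfl⟩ := Finset.mem_image.1 hx
      obtain ⟨h1, h2⟩ := hT η hη
      have hη0 : η ≠ 0 := by rintro rfl; simp [hq0.ne'] at h1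
      have h1k : (η ^ k) ^ q = 1 := by rw [← pow_mul, mul_comm, pow_mul, h1, one_pow]
      have hj := hJ _ h1k h2
      have hf := hfac _ hj h1k
      have x1 : (C η : ℂ[X]) ^ (2 * (L : ℤ) + r e).toNat
          = C (η ^ (2 * L)) * C ((η ^ k) ^ e) := by
        rw [← C_pow, ← C_mul]; congr 1
        rw [show (2 * (L : ℤ) + r e).toNat = L + (L + r e).toNat by omega, pow_add,
          pow_toNat hq0 h1 (c := (L + r e).toNat) hre1 hre2 (by omega)]
        ring
      have x2 : (C η : ℂ[X]) ^ (2 * (L : ℤ) - r e).toNat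
          = C (η ^ (2 * L)) * C (((η ^ k) ^ e)⁻¹) := by
        have hh : (C η : ℂ[X]) ^ (2 * (L : ℤ) - r e).toNat * C η ^ (2 * (L : ℤ) + r e).toNat
            = C (η ^ (4 * L)) := by
          rw [← pow_add, ← C_pow]; congr 2; omega
        rw [x1] at hh
        have hc : ((η ^ k) ^ e) ≠ 0 := pow_ne_zero _ (pow_ne_zero _ hη0)
        have hc2 : η ^ (2 * L) ≠ 0 := pow_ne_zero _ hη0
        have hne : C (η ^ (2 * L)) * C ((η ^ k) ^ e) ≠ (0 : ℂ[X]) := by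
          rw [← C_mul, Ne, C_eq_zero]; exact mul_ne_zero hc2 hc
        apply mul_right_cancel₀ hne
        rw [hh, ← C_mul, ← C_mul, ← C_mul]; congr 1
        field_simp
        ring
      rw [eval_sub, eval_mul, evG η h1 hj, evG' η h1 hj, target]
      simp only [eval_sub, eval_mul, eval_C, eval_pow, eval_X]
      rw [x1, x2, sub_eq_zero]
      have : C (η ^ L) * spec (A (η ^ k)) d * (C (η ^ L) * spec (B (η ^ k)) d')
        = C (η ^ (2 * L)) * (spec (A (η ^ k)) d * spec (B (η ^ k)) d') := by
        rw [show 2 * L = L + L by ring, pow_add, C_mul]; ring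
      rw [this, hf, mul_inv, C_add, C_mul, C_mul, ← C_pow]
      ring
    · rw [Finset.card_image_of_injective _ C_injective]
      refine lt_of_le_of_lt (b := 4 * L) ?_ (by omega)
      have m1 : G.natDegree ≤ 2 * L := mkG_natDegree β S r L d fun i hi => (hrS i hi).1
      have m2 : G'.natDegree ≤ 2 * L := mkG_natDegree β' S r L d' fun i hi => (hrS i hi).1
      refine (natDegree_sub_le _ _).trans (max_le (natDegree_mul_le.trans (by omega)) ?_)
      rw [target]
      refine (natDegree_sub_le _ _).trans (max_le ((natDegree_sub_le _ _).trans (max_le ?_ ?_)) ?_)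
      all_goals refine (natDegree_C_mul_X_pow_le _ _).trans (by omega)
  by_cases hre0 : r e = 0
  · refine ⟨k, hk0, by omega, ?_, ?_⟩
    · rw [hre0, sub_zero] at hre2; exact_mod_cast hre2
    · have ht : target P L (r e) ω ω⁻¹ = C (P * X - 1 - C ω * P - C ω⁻¹ * P) * X ^ (2 * L) := by
        rw [target, hre0]
        have : (2 * (L : ℤ)).toNat = 2 * L := by omega
        simp only [add_zero, sub_zero, this, C_sub]
        ring
      have hF : P * X - 1 - C ω * P - C ω⁻¹ * P ≠ 0 := by
        intro h0
        have hdeg : (P * (X - C (ω + ω⁻¹))).natDegree = P.natDegree + 1 := by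
          rw [hP.natDegree_mul (monic_X_sub_C _), natDegree_X_sub_C]
        have : P * (X - C (ω + ω⁻¹)) = 1 := by
          rw [C_add]; linear_combination h0
        rw [this] at hdeg; simp at hdeg
      obtain ⟨z1, z2⟩ := ff_zero hF (mkG_shape β S r L d) (mkG_shape β' S r L d') (hprod.trans ht)
      refine ⟨G.coeff L, G'.coeff L, fun η h1 h2 => ?_⟩
      have hη0 : η ≠ 0 := by rintro rfl; simp [hq0.ne'] at h1
      have hne : (C (η ^ L) : ℂ[X]) ≠ 0 := by rw [Ne, C_eq_zero]; exact pow_ne_zero _ hη0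
      have y1 := evG η h1 h2
      have y2 := evG' η h1 h2
      have z1' : G = C (G.coeff L) * X ^ L := z1
      have z2' : G' = C (G'.coeff L) * X ^ L := z2
      rw [z1'] at y1; rw [z2'] at y2
      simp only [eval_mul, eval_C, eval_pow, eval_X, ← C_pow] at y1 y2
      rw [mul_comm] at y1 y2
      exact ⟨(mul_left_cancel₀ hne y1).symm, (mul_left_cancel₀ hne y2).symm⟩
  · exact (ff_main hP hsep heven hre0 (by omega) hω (inv_ne_zero hω) (mkG_shape β S r L d)
      (mkG_shape β' S r L d') hprod hd hd0 hd0').elim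


noncomputable def sec (q i : ℕ) (A : ℤ[X]) : ℤ[X] :=
  ∑ n ∈ A.support.filter (fun n => n % q = i), C (A.coeff n) * X ^ n

lemma aeval_sec (q i : ℕ) (A : ℤ[X]) (ξ : ℂ) : aeval ξ (sec q i A) =
    ∑ n ∈ A.support.filter (fun n => n % q = i), (A.coeff n : ℂ) * ξ ^ n := by
  simp [sec]

lemma aeval_sec_mul {q i : ℕ} (A : ℤ[X]) (ξ : ℂ) {η : ℂ} (hη : η ^ q = 1) :
    aeval (ξ * η) (sec q i A) = aeval ξ (sec q i A) * η ^ i := by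
  rw [aeval_sec, aeval_sec, Finset.sum_mul]
  refine Finset.sum_congr rfl fun n hn => ?_
  have h1 := (Finset.mem_filter.1 hn).2
  have : η ^ n = η ^ i := by
    conv_lhs => rw [← Nat.div_add_mod n q, pow_add, pow_mul, hη, one_pow, one_mul, h1]
  rw [mul_pow, this]; ring

lemma aeval_eq_sum_sec {q : ℕ} (hq : 0 < q) (A : ℤ[X]) (ξ : ℂ) :
    aeval ξ A = ∑ i ∈ Finset.range q, aeval ξ (sec q i A) := by
  simp only [aeval_sec]
  rw [Finset.sum_fiberwise_of_maps_to (g := fun n => n % q)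
    (fun n _ => Finset.mem_range.2 (Nat.mod_lt n hq)), aeval_def, eval₂_eq_sum, Polynomial.sum]
  rfl

lemma aeval_mul_eq {q : ℕ} (hq : 0 < q) (A : ℤ[X]) (ξ : ℂ) {η : ℂ} (hη : η ^ q = 1) :
    aeval (ξ * η) A = ∑ i ∈ Finset.range q, aeval ξ (sec q i A) * η ^ i := by
  rw [aeval_eq_sum_sec hq]
  exact Finset.sum_congr rfl fun i _ => aeval_sec_mul A ξ hη

lemma parseval {q : ℕ} (hq : 0 < q) {η : ℂ} (hη : IsPrimitiveRoot η q) (α : ℕ → ℂ) :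
    ∑ j ∈ Finset.range q, ‖∑ i ∈ Finset.range q, α i * (η ^ j) ^ i‖ ^ 2 =
      q * ∑ i ∈ Finset.range q, ‖α i‖ ^ 2 := by
  have hn : ‖η‖ = 1 := hη.norm'_eq_one hq.ne'
  have hη0 : η ≠ 0 := by rintro rfl; simp at hn
  have hc : (starRingEnd ℂ) η = η⁻¹ := by
    rw [Complex.inv_def, Complex.normSq_eq_norm_sq, hn]; simp
  have key : ∀ i ∈ Finset.range q, ∀ i' ∈ Finset.range q,
      ∑ j ∈ Finset.range q, (η ^ j) ^ i * ((η⁻¹) ^ j) ^ i' = if i = i' then (q : ℂ) else 0 := by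
    intro i hi i' hi'
    split_ifs with h
    · subst h
      have : ∀ j ∈ Finset.range q, (η ^ j) ^ i * ((η⁻¹) ^ j) ^ i = 1 := by
        intro j _
        rw [← mul_pow, ← mul_pow, mul_inv_cancel₀ hη0]; simp
      rw [Finset.sum_congr rfl this]; simp
    · have h2 : ∀ j ∈ Finset.range q, (η ^ j) ^ i * ((η⁻¹) ^ j) ^ i' = (η ^ i * (η⁻¹) ^ i') ^ j := by
        intro j _
        rw [mul_pow, ← pow_mul, ← pow_mul, ← pow_mul, ← pow_mul, mul_comm j i, mul_comm j i']
      rw [Finset.sum_congr rfl h2]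
      have h3 : η ^ i * (η⁻¹) ^ i' ≠ 1 := by
        intro h4
        apply h
        rw [inv_pow, mul_inv_eq_one₀ (pow_ne_zero _ hη0)] at h4
        exact hη.pow_inj (Finset.mem_range.1 hi) (Finset.mem_range.1 hi') h4
      have h4 : (η ^ i * (η⁻¹) ^ i') ^ q = 1 := by
        rw [mul_pow, ← pow_mul, ← pow_mul, mul_comm i, mul_comm i', pow_mul, pow_mul, inv_pow,
          hη.pow_eq_one]; simp
      rw [geom_sum_eq h3, h4]; simp
  have hcx : ((∑ j ∈ Finset.range q, ‖∑ i ∈ Finset.range q, α i * (η ^ j) ^ i‖ ^ 2 : ℝ) : ℂ) =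
      ((q * ∑ i ∈ Finset.range q, ‖α i‖ ^ 2 : ℝ) : ℂ) := by
    push_cast
    have e1 : ∀ z : ℂ, (‖z‖ : ℂ) ^ 2 = z * (starRingEnd ℂ) z := fun z => by
      rw [Complex.mul_conj, Complex.normSq_eq_norm_sq]; push_cast; rfl
    simp only [e1, map_sum, map_mul, map_pow, hc, Finset.sum_mul_sum]
    rw [Finset.sum_comm, Finset.mul_sum]
    refine Finset.sum_congr rfl fun i hi => ?_
    rw [Finset.sum_comm]
    have : ∀ i' ∈ Finset.range q, ∑ j ∈ Finset.range q, α i * (η ^ j) ^ i *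
        ((starRingEnd ℂ) (α i') * ((η⁻¹) ^ j) ^ i') =
        α i * (starRingEnd ℂ) (α i') * if i = i' then (q : ℂ) else 0 := by
      intro i' hi'
      rw [← key i hi i' hi', Finset.mul_sum]
      exact Finset.sum_congr rfl fun j _ => by ring
    rw [Finset.sum_congr rfl this]
    simp only [mul_ite, mul_zero]
    rw [Finset.sum_ite_eq, if_pos hi]; ring
  exact_mod_cast hcx

lemma lagrange {q : ℕ} (α : ℕ → ℂ) :
    ∑ i ∈ Finset.range q, ∑ i' ∈ Finset.range q, ‖α i - α i'‖ ^ 2 =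
      2 * (q * ∑ i ∈ Finset.range q, ‖α i‖ ^ 2 - ‖∑ i ∈ Finset.range q, α i‖ ^ 2) := by
  have hcx : ((∑ i ∈ Finset.range q, ∑ i' ∈ Finset.range q, ‖α i - α i'‖ ^ 2 : ℝ) : ℂ) =
      ((2 * (q * ∑ i ∈ Finset.range q, ‖α i‖ ^ 2 - ‖∑ i ∈ Finset.range q, α i‖ ^ 2) : ℝ) : ℂ) := by
    push_cast
    have e1 : ∀ z : ℂ, (‖z‖ : ℂ) ^ 2 = z * (starRingEnd ℂ) z := fun z => by
      rw [Complex.mul_conj, Complex.normSq_eq_norm_sq]; push_cast; rfl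
    simp only [e1, map_sub, map_sum]
    have : ∀ i i', (α i - α i') * ((starRingEnd ℂ) (α i) - (starRingEnd ℂ) (α i')) =
      α i * (starRingEnd ℂ) (α i) + α i' * (starRingEnd ℂ) (α i') -
       α i * (starRingEnd ℂ) (α i') - α i' * (starRingEnd ℂ) (α i) := fun i i' => by ring
    simp only [this, Finset.sum_add_distrib, Finset.sum_sub_distrib, ← Finset.mul_sum,
      ← Finset.sum_mul]
    simp
    have h2 : ∑ x ∈ Finset.range q, α x * ((q : ℂ) * (starRingEnd ℂ) (α x)) =
        q * ∑ x ∈ Finset.range q, α x * (starRingEnd ℂ) (α x) := by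
      rw [Finset.mul_sum]; exact Finset.sum_congr rfl fun _ _ => by ring
    rw [h2]
    ring
  exact_mod_cast hcx

lemma prim_transfer {M : ℕ} (hM : 0 < M) {ξ ζ : ℂ} (hξ : IsPrimitiveRoot ξ M)
    (hζ : IsPrimitiveRoot ζ M) {G : ℤ[X]} (h : aeval ξ G = 0) : aeval ζ G = 0 := by
  have h1 : minpoly ℤ ξ ∣ G := minpoly.isIntegrallyClosed_dvd (hξ.isIntegral hM) h
  rw [← cyclotomic_eq_minpoly hξ hM, cyclotomic_eq_minpoly hζ hM] at h1
  obtain ⟨H, rfl⟩ := h1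
  simp

lemma amgm {M : ℕ} (hM : 0 < M) {ξ : ℂ} (hξ : IsPrimitiveRoot ξ M) {G : ℤ[X]}
    (h : aeval ξ G ≠ 0) :
    ((primitiveRoots M ℂ).card : ℝ) ≤ ∑ ζ ∈ primitiveRoots M ℂ, ‖aeval ζ G‖ ^ 2 := by
  have hne : ∀ ζ ∈ primitiveRoots M ℂ, aeval ζ G ≠ 0 := fun ζ hζ h0 =>
    h (prim_transfer hM ((mem_primitiveRoots hM).1 hζ) hξ h0)
  have : NeZero (M : ℂ) := ⟨by exact_mod_cast hM.ne'⟩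
  obtain ⟨z, hz⟩ : ∃ z : ℤ, ∏ ζ ∈ primitiveRoots M ℂ, aeval ζ G = (z : ℂ) := by
    refine ⟨resultant (cyclotomic M ℤ) G (cyclotomic M ℤ).natDegree G.natDegree, ?_⟩
    have h1 := resultant_eq_prod_eval (cyclotomic M ℂ) (G.map (Int.castRingHom ℂ)) G.natDegree
      natDegree_map_le (IsAlgClosed.splits _)
    rw [(cyclotomic.monic M ℂ).leadingCoeff, one_pow, one_mul,
      cyclotomic.roots_eq_primitiveRoots_val, ← map_cyclotomic_int M ℂ, resultant_map_map,
      natDegree_map_eq_of_injective (RingHom.injective_int _)] at h1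
    rw [← eq_intCast (Int.castRingHom ℂ), h1]
    simp only [Finset.prod, aeval_def, eval_map]
    rfl
  have hz0 : z ≠ 0 := by
    rintro rfl
    rw [Int.cast_zero, Finset.prod_eq_zero_iff] at hz
    obtain ⟨ζ, h1, h2⟩ := hz
    exact hne ζ h1 h2
  have hz1 : 1 ≤ ∏ ζ ∈ primitiveRoots M ℂ, ‖aeval ζ G‖ ^ 2 := by
    rw [Finset.prod_pow, ← norm_prod, hz]
    apply one_le_pow₀
    rw [Complex.norm_intCast]
    exact_mod_cast Int.one_le_abs hz0
  have hpos : ∀ ζ ∈ primitiveRoots M ℂ, 0 < ‖aeval ζ G‖ ^ 2 := fun ζ hζ => by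
    have := norm_pos_iff.2 (hne ζ hζ); positivity
  have hlog := Real.log_nonneg hz1
  rw [Real.log_prod fun ζ hζ => (hpos ζ hζ).ne'] at hlog
  have h3 : ∑ ζ ∈ primitiveRoots M ℂ, Real.log (‖aeval ζ G‖ ^ 2) ≤
      ∑ ζ ∈ primitiveRoots M ℂ, (‖aeval ζ G‖ ^ 2 - 1) :=
    Finset.sum_le_sum fun ζ hζ => Real.log_le_sub_one_of_pos (hpos ζ hζ)
  rw [Finset.sum_sub_distrib] at h3
  have h4 := hlog.trans h3
  simpa using h4

lemma house {P : ℂ[X]} (hP : 0 < P.natDegree) : ∃ B0 : ℝ, 0 ≤ B0 ∧ ∀ y : ℂ, ‖y‖ ≤ 2 →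
    ∀ (γ γ' : ℕ → ℂ) (d d' : ℕ), d ≤ P.natDegree + 1 →
    spec γ d * spec γ' d' = P * (X - C y) - 1 → ∀ a < d, ‖γ a‖ ≤ B0 := by
  have h1 := (P.tendsto_norm_atTop (natDegree_pos_iff_degree_pos.1 hP)
    (tendsto_norm_cobounded_atTop (E := ℂ))).eventually (Filter.eventually_ge_atTop 1)
  rw [(Filter.HasBasis.cobounded_of_norm (E := ℂ) Filter.atTop_basis).eventually_iff] at h1
  obtain ⟨R, -, hR⟩ := h1
  refine ⟨max (max R 4) 1 ^ (P.natDegree + 1) * (P.natDegree + 1).choose ((P.natDegree + 1) / 2),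
    by positivity, ?_⟩
  intro y hy γ γ' d d' hd hfac a ha
  have := coeff_bdd_of_roots_le (B := max R 4) (d := P.natDegree + 1) (RingHom.id ℂ)
    (spec_monic γ d) (IsAlgClosed.splits _) (by rw [spec_natDegree]; exact hd) ?_ a
  · rwa [Polynomial.map_id, spec_coeff γ d a ha] at this
  · intro z hz
    rw [Polynomial.map_id, mem_roots (spec_monic γ d).ne_zero, IsRoot.def] at hz
    by_contra! hlt
    have h2 : 1 ≤ ‖P.eval z‖ := hR (by simpa using (le_max_left R 4).trans hlt.le)
    have h3 := congrArg (eval z) hfac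
    simp only [eval_mul, hz, zero_mul, eval_sub, eval_X, eval_C, eval_one] at h3
    have h4 : P.eval z * (z - y) = 1 := by linear_combination -h3
    have h5 := congrArg norm h4
    rw [norm_mul, norm_one] at h5
    have h6 : 4 < ‖z‖ := (le_max_right R 4).trans_lt hlt
    have h7 := norm_sub_norm_le z y
    nlinarith

lemma pow_range_of_prim {q : ℕ} {η0 : ℂ} (h0 : IsPrimitiveRoot η0 q) (j : ℕ) : (η0 ^ j) ^ q = 1 := by
  rw [← pow_mul, mul_comm, pow_mul, h0.pow_eq_one, one_pow]

lemma support2 {M q : ℕ} (hM : 0 < M) (hq : 0 < q)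
    (hmul : ∀ ζ η : ℂ, IsPrimitiveRoot ζ M → η ^ q = 1 → IsPrimitiveRoot (ζ * η) M)
    {B : ℝ} (A : ℤ[X]) (hB : ∀ ζ : ℂ, IsPrimitiveRoot ζ M → ‖aeval ζ A‖ ≤ B)
    (ξ : ℂ) (hξ : IsPrimitiveRoot ξ M) :
    (((Finset.range q).filter (fun i => aeval ξ (sec q i A) ≠ 0)).card : ℝ) ≤ B ^ 2 := by
  obtain ⟨η0, hη0⟩ : ∃ η0 : ℂ, IsPrimitiveRoot η0 q := ⟨_, Complex.isPrimitiveRoot_exp q hq.ne'⟩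
  set Z := primitiveRoots M ℂ with hZ
  have hZpos : 0 < (Z.card : ℝ) := by
    have : ξ ∈ Z := (mem_primitiveRoots hM).2 hξ
    exact_mod_cast Finset.card_pos.2 ⟨ξ, this⟩
  have hqR : 0 < (q : ℝ) := by exact_mod_cast hq
  have h1 : ∀ ζ ∈ Z, ∑ i ∈ Finset.range q, ‖aeval ζ (sec q i A)‖ ^ 2 ≤ B ^ 2 := by
    intro ζ hζ
    have hp := (mem_primitiveRoots hM).1 hζ
    have h2 := parseval hq hη0 (fun i => aeval ζ (sec q i A))
    have h3 : ∑ j ∈ Finset.range q, ‖∑ i ∈ Finset.range q, aeval ζ (sec q i A) * (η0 ^ j) ^ i‖ ^ 2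
        ≤ ∑ j ∈ Finset.range q, B ^ 2 := by
      refine Finset.sum_le_sum fun j _ => ?_
      have hj := pow_range_of_prim hη0 j
      rw [← aeval_mul_eq hq A ζ hj]
      exact pow_le_pow_left₀ (norm_nonneg _) (hB _ (hmul _ _ hp hj)) 2
    rw [h2] at h3
    simp only [Finset.sum_const, Finset.card_range, nsmul_eq_mul] at h3
    exact le_of_mul_le_mul_left h3 hqR
  have h2 := Finset.sum_le_sum h1
  rw [Finset.sum_comm] at h2
  simp only [Finset.sum_const, nsmul_eq_mul] at h2
  have h3 : ∑ i ∈ (Finset.range q).filter (fun i => aeval ξ (sec q i A) ≠ 0), (Z.card : ℝ) ≤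
      ∑ i ∈ Finset.range q, ∑ ζ ∈ Z, ‖aeval ζ (sec q i A)‖ ^ 2 := by
    refine (Finset.sum_le_sum (g := fun i => ∑ ζ ∈ Z, ‖aeval ζ (sec q i A)‖ ^ 2) ?_).trans
      (Finset.sum_le_sum_of_subset_of_nonneg (Finset.filter_subset _ _) fun i _ _ =>
        Finset.sum_nonneg fun ζ _ => by positivity)
    intro i hi
    exact amgm hM hξ (Finset.mem_filter.1 hi).2
  simp only [Finset.sum_const, nsmul_eq_mul] at h3
  have h4 := h3.trans h2
  rw [mul_comm] at h4
  exact le_of_mul_le_mul_left h4 hZpos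

lemma support1 {M p : ℕ} (hM : 0 < M) (hp : 0 < p)
    {B : ℝ} (A : ℤ[X])
    (hB : ∀ ζ η : ℂ, IsPrimitiveRoot ζ M → η ^ p = 1 → η ≠ 1 → ‖aeval (ζ * η) A‖ ≤ B)
    (ξ : ℂ) (hξ : IsPrimitiveRoot ξ M) :
    ∃ i0, (((Finset.range p).filter
      (fun i => aeval ξ (sec p i A) ≠ aeval ξ (sec p i0 A))).card : ℝ) ≤ 2 * B ^ 2 := by
  obtain ⟨η0, hη0⟩ : ∃ η0 : ℂ, IsPrimitiveRoot η0 p := ⟨_, Complex.isPrimitiveRoot_exp p hp.ne'⟩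
  set Z := primitiveRoots M ℂ with hZ
  have hZpos : 0 < (Z.card : ℝ) := by
    have : ξ ∈ Z := (mem_primitiveRoots hM).2 hξ
    exact_mod_cast Finset.card_pos.2 ⟨ξ, this⟩
  have hqR : 0 < (p : ℝ) := by exact_mod_cast hp
  have h1 : ∀ ζ ∈ Z, ∑ i ∈ Finset.range p, ∑ i' ∈ Finset.range p,
      ‖aeval ζ (sec p i A) - aeval ζ (sec p i' A)‖ ^ 2 ≤ 2 * (p * B ^ 2) := by
    intro ζ hζ
    have hpr := (mem_primitiveRoots hM).1 hζ
    rw [lagrange (q := p) (fun i => aeval ζ (sec p i A)),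
      ← parseval hp hη0 (fun i => aeval ζ (sec p i A))]
    have h0 : 0 ∈ Finset.range p := Finset.mem_range.2 hp
    rw [← Finset.add_sum_erase _ _ h0]
    simp only [pow_zero, one_pow, mul_one, add_sub_cancel_left]
    gcongr
    refine (Finset.sum_le_sum (g := fun _ => B ^ 2) ?_).trans ?_
    · intro j hj
      have hj1 := pow_range_of_prim hη0 j
      rw [← aeval_mul_eq hp A ζ hj1]
      refine pow_le_pow_left₀ (norm_nonneg _) (hB _ _ hpr hj1 ?_) 2
      rw [Finset.mem_erase, Finset.mem_range] at hj
      exact hη0.pow_ne_one_of_pos_of_lt hj.1 hj.2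
    · rw [Finset.sum_const, nsmul_eq_mul]
      gcongr
      exact (Finset.card_erase_le).trans (by simp)
  have h2 := Finset.sum_le_sum h1
  rw [Finset.sum_comm] at h2
  simp only [Finset.sum_const, nsmul_eq_mul] at h2
  have h3 : ∀ i, (Z.card : ℝ) * ((Finset.range p).filter
      (fun i' => aeval ξ (sec p i' A) ≠ aeval ξ (sec p i A))).card ≤
      ∑ ζ ∈ Z, ∑ i' ∈ Finset.range p, ‖aeval ζ (sec p i A) - aeval ζ (sec p i' A)‖ ^ 2 := by
    intro i
    rw [Finset.sum_comm]
    have h4 : ∑ i' ∈ (Finset.range p).filter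
      (fun i' => aeval ξ (sec p i' A) ≠ aeval ξ (sec p i A)), (Z.card : ℝ) ≤
      ∑ i' ∈ Finset.range p, ∑ ζ ∈ Z, ‖aeval ζ (sec p i A) - aeval ζ (sec p i' A)‖ ^ 2 := by
      refine (Finset.sum_le_sum (g := fun i' => ∑ ζ ∈ Z,
        ‖aeval ζ (sec p i A) - aeval ζ (sec p i' A)‖ ^ 2) ?_).trans
        (Finset.sum_le_sum_of_subset_of_nonneg (Finset.filter_subset _ _) fun i _ _ =>
          Finset.sum_nonneg fun ζ _ => by positivity)
      intro i' hi'
      have h5 : aeval ξ (sec p i A - sec p i' A) ≠ 0 := by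
        rw [map_sub, sub_ne_zero]; exact (Finset.mem_filter.1 hi').2.symm
      have h6 := amgm hM hξ h5
      simpa only [map_sub] using h6
    rw [Finset.sum_const, nsmul_eq_mul, mul_comm] at h4
    exact h4
  obtain ⟨i0, -, hi0⟩ := Finset.exists_le_of_sum_le (s := Finset.range p)
    (f := fun i => (Z.card : ℝ) * ((Finset.range p).filter
      (fun i' => aeval ξ (sec p i' A) ≠ aeval ξ (sec p i A))).card)
    (g := fun i => (Z.card : ℝ) * (2 * B ^ 2)) ⟨0, Finset.mem_range.2 hp⟩ (by
      refine ((Finset.sum_le_sum fun i _ => h3 i).trans h2).trans ?_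
      simp only [Finset.sum_const, nsmul_eq_mul, Finset.card_range]
      apply le_of_eq; ring)
  exact ⟨i0, le_of_mul_le_mul_left hi0 hZpos⟩


def Fac (P : ℂ[X]) (N M : ℕ) : Prop :=
  ∃ (e d d' : ℕ) (A B : ℕ → ℤ[X]), 0 < d ∧ 0 < d' ∧ P.natDegree + 1 = d + d' ∧
    ∀ ζ : ℂ, IsPrimitiveRoot ζ M → IsPrimitiveRoot (ζ ^ e) N ∧
      spec (fun a => aeval ζ (A a)) d * spec (fun a => aeval ζ (B a)) d' =
        P * (X - C (ζ ^ e + (ζ ^ e)⁻¹)) - 1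

def House (P : ℂ[X]) (B0 : ℝ) : Prop := ∀ y : ℂ, ‖y‖ ≤ 2 →
    ∀ (γ γ' : ℕ → ℂ) (d d' : ℕ), d ≤ P.natDegree + 1 →
    spec γ d * spec γ' d' = P * (X - C y) - 1 → ∀ a < d, ‖γ a‖ ≤ B0

lemma norm_two {ω : ℂ} (h : ‖ω‖ = 1) : ‖ω + ω⁻¹‖ ≤ 2 := by
  refine (norm_add_le _ _).trans ?_
  rw [norm_inv, h]; norm_num

lemma const_lemma {p : ℕ} (hp : 2 ≤ p) (α : ℕ → ℂ) (γ : ℂ)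
    (h : ∀ η : ℂ, η ^ p = 1 → η ≠ 1 → ∑ i ∈ Finset.range p, α i * η ^ i = γ) :
    γ = α 0 - α 1 := by
  have hp0 : 0 < p := by omega
  obtain ⟨η0, hη0⟩ : ∃ η0 : ℂ, IsPrimitiveRoot η0 p := ⟨_, Complex.isPrimitiveRoot_exp p hp0.ne'⟩
  have h0 : 0 ∈ Finset.range p := Finset.mem_range.2 hp0
  set α' : ℕ → ℂ := fun i => α i - if i = 0 then γ else 0 with hα'
  have hs : ∀ η : ℂ, ∑ i ∈ Finset.range p, α' i * η ^ i =
      ∑ i ∈ Finset.range p, α i * η ^ i - γ := by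
    intro η
    simp only [hα', sub_mul, Finset.sum_sub_distrib, ite_mul, zero_mul]
    rw [Finset.sum_ite_eq', if_pos h0]; simp
  have h1 := parseval hp0 hη0 α'
  have h2 := lagrange (q := p) α'
  rw [← Finset.add_sum_erase _ _ h0, Finset.sum_eq_zero (s := (Finset.range p).erase 0)] at h1
  · rw [← h1] at h2
    simp only [pow_zero, one_pow, mul_one, add_zero, sub_self, mul_zero] at h2
    rw [Finset.sum_eq_zero_iff_of_nonneg
      (fun i _ => Finset.sum_nonneg fun i' _ => by positivity)] at h2
    have h3 := h2 0 h0
    rw [Finset.sum_eq_zero_iff_of_nonneg (fun i' _ => by positivity)] at h3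
    have h4 := h3 1 (Finset.mem_range.2 (by omega))
    rw [sq_eq_zero_iff, norm_eq_zero] at h4
    simp [hα'] at h4
    linear_combination -h4
  · intro j hj
    rw [Finset.mem_erase, Finset.mem_range] at hj
    rw [hs, h _ (pow_range_of_prim hη0 j) (hη0.pow_ne_one_of_pos_of_lt hj.1 hj.2)]
    simp

lemma const_lemma2 {p : ℕ} (hp0 : 0 < p) (α : ℕ → ℂ) (γ : ℂ)
    (h : ∀ η : ℂ, η ^ p = 1 → ∑ i ∈ Finset.range p, α i * η ^ i = γ) :
    γ = α 0 := by
  obtain ⟨η0, hη0⟩ : ∃ η0 : ℂ, IsPrimitiveRoot η0 p := ⟨_, Complex.isPrimitiveRoot_exp p hp0.ne'⟩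
  have h0 : 0 ∈ Finset.range p := Finset.mem_range.2 hp0
  set α' : ℕ → ℂ := fun i => α i - if i = 0 then γ else 0 with hα'
  have hs : ∀ η : ℂ, ∑ i ∈ Finset.range p, α' i * η ^ i =
      ∑ i ∈ Finset.range p, α i * η ^ i - γ := by
    intro η
    simp only [hα', sub_mul, Finset.sum_sub_distrib, ite_mul, zero_mul]
    rw [Finset.sum_ite_eq', if_pos h0]; simp
  have h1 := parseval hp0 hη0 α'
  rw [Finset.sum_eq_zero] at h1
  · have hpR : (p : ℝ) ≠ 0 := by exact_mod_cast hp0.ne'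
    have h2 := (mul_eq_zero.1 h1.symm).resolve_left hpR
    rw [Finset.sum_eq_zero_iff_of_nonneg (fun i' _ => by positivity)] at h2
    have h4 := h2 0 h0
    rw [sq_eq_zero_iff, norm_eq_zero] at h4
    simp [hα'] at h4
    linear_combination -h4
  · intro j hj
    rw [hs, h _ (pow_range_of_prim hη0 j)]
    simp

lemma card_union_bound {d d' q : ℕ} {b : ℝ} (F F' : ℕ → Finset ℕ)
    (h : ∀ a < d, ((F a).card : ℝ) ≤ b) (h' : ∀ a < d', ((F' a).card : ℝ) ≤ b)
    (hq : 2 * 16 ^ ((d + d') * ⌊b⌋₊ + 1) < q) :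
    2 * 16 ^ (((Finset.range d).biUnion F ∪ (Finset.range d').biUnion F').card + 1) < q := by
  refine lt_of_le_of_lt ?_ hq
  have h1 : ((Finset.range d).biUnion F).card ≤ (Finset.range d).card * ⌊b⌋₊ :=
    Finset.card_biUnion_le_card_mul _ _ _ fun a ha => Nat.le_floor (h a (Finset.mem_range.1 ha))
  have h2 : ((Finset.range d').biUnion F').card ≤ (Finset.range d').card * ⌊b⌋₊ :=
    Finset.card_biUnion_le_card_mul _ _ _ fun a ha => Nat.le_floor (h' a (Finset.mem_range.1 ha))
  rw [Finset.card_range] at h1 h2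
  have h3 := Finset.card_union_le ((Finset.range d).biUnion F) ((Finset.range d').biUnion F')
  gcongr
  · norm_num
  · rw [add_mul]; omega

lemma prim_mul_coprime {M p : ℕ} (hp : p.Prime) (hcop : M.Coprime p) {ξ η : ℂ}
    (hξ : IsPrimitiveRoot ξ M) (hη : η ^ p = 1) (hη1 : η ≠ 1) : IsPrimitiveRoot (ξ * η) (M * p) := by
  haveI : Fact p.Prime := ⟨hp⟩
  have h1 : orderOf η = p := orderOf_eq_prime hη hη1
  have h2 : orderOf ξ = M := hξ.eq_orderOf.symm
  have h3 := (Commute.all ξ η).orderOf_mul_eq_mul_orderOf_of_coprime (by rw [h1, h2]; exact hcop)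
  rw [h1, h2] at h3
  rw [← h3]; exact IsPrimitiveRoot.orderOf _

lemma Fac_house {P : ℂ[X]} {B0 : ℝ} (hH : House P B0) {e d d' : ℕ} {A B : ℕ → ℤ[X]}
    (hdd : P.natDegree + 1 = d + d') {ζ : ℂ} {M : ℕ} (hM : 0 < M) (hζ : IsPrimitiveRoot ζ M)
    (h : spec (fun a => aeval ζ (A a)) d * spec (fun a => aeval ζ (B a)) d' =
        P * (X - C (ζ ^ e + (ζ ^ e)⁻¹)) - 1) :
    (∀ a < d, ‖aeval ζ (A a)‖ ≤ B0) ∧ (∀ a < d', ‖aeval ζ (B a)‖ ≤ B0) := by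
  have hn : ‖ζ ^ e + (ζ ^ e)⁻¹‖ ≤ 2 := norm_two (by rw [norm_pow, hζ.norm'_eq_one hM.ne', one_pow])
  exact ⟨hH _ hn _ _ _ _ (by omega) h, hH _ hn _ _ _ _ (by omega) (by rw [mul_comm]; exact h)⟩

lemma sum_reduce {p : ℕ} (hp0 : 0 < p) {η : ℂ} (hη : η ^ p = 1) (hη1 : η ≠ 1) (α : ℕ → ℂ) (c : ℂ)
    (S : Finset ℕ) (hS : S ⊆ Finset.range p) (h : ∀ i ∈ Finset.range p, α i ≠ c → i ∈ S) :
    ∑ i ∈ Finset.range p, α i * η ^ i = ∑ i ∈ S, (α i - c) * η ^ i := by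
  have h1 : ∑ i ∈ Finset.range p, c * η ^ i = 0 := by
    rw [← Finset.mul_sum, geom_sum_eq hη1, hη]; simp
  rw [← sub_zero (∑ i ∈ Finset.range p, α i * η ^ i), ← h1, ← Finset.sum_sub_distrib]
  symm
  rw [Finset.sum_congr rfl fun i _ => sub_mul (α i) c (η ^ i)]
  refine Finset.sum_subset hS fun i hi hiS => ?_
  have : α i = c := by by_contra h2; exact hiS (h i hi h2)
  rw [this, sub_self]

lemma descent1 {P : ℂ[X]} (hP : P.Monic) (hsep : P.roots.Nodup) (heven : Even P.natDegree)
    {B0 : ℝ} (hH : House P B0) {N M p : ℕ} (hp : p.Prime) (hM : 0 < M) (hcop : M.Coprime p)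
    (hbig : 2 * 16 ^ ((P.natDegree + 1) * ⌊2 * B0 ^ 2⌋₊ + 1) < p) (h : Fac P N (M * p)) :
    Fac P N M := by
  obtain ⟨e, d, d', A, B, hd, hd', hdd, hfac⟩ := h
  have hp0 := hp.pos
  have hMp : 0 < M * p := Nat.mul_pos hM hp0
  refine ⟨e, d, d', fun a => sec p 0 (A a) - sec p 1 (A a), fun a => sec p 0 (B a) - sec p 1 (B a),
    hd, hd', hdd, fun ξ hξ => ?_⟩
  have hmul := fun (ζ η : ℂ) (h1 : IsPrimitiveRoot ζ M) (h2 : η ^ p = 1) (h3 : η ≠ 1) =>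
    prim_mul_coprime hp hcop h1 h2 h3
  have s1 : ∀ a, ∃ i0, a < d → (((Finset.range p).filter
      (fun i => aeval ξ (sec p i (A a)) ≠ aeval ξ (sec p i0 (A a)))).card : ℝ) ≤ 2 * B0 ^ 2 := by
    intro a
    by_cases ha : a < d
    · obtain ⟨i0, hi0⟩ := support1 hM hp0 (A a) (fun ζ η h1 h2 h3 =>
        (Fac_house hH hdd hMp (hmul ζ η h1 h2 h3) (hfac _ (hmul ζ η h1 h2 h3)).2).1 a ha) ξ hξ
      exact ⟨i0, fun _ => hi0⟩
    · exact ⟨0, fun h => absurd h ha⟩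
  have s2 : ∀ a, ∃ i0, a < d' → (((Finset.range p).filter
      (fun i => aeval ξ (sec p i (B a)) ≠ aeval ξ (sec p i0 (B a)))).card : ℝ) ≤ 2 * B0 ^ 2 := by
    intro a
    by_cases ha : a < d'
    · obtain ⟨i0, hi0⟩ := support1 hM hp0 (B a) (fun ζ η h1 h2 h3 =>
        (Fac_house hH hdd hMp (hmul ζ η h1 h2 h3) (hfac _ (hmul ζ η h1 h2 h3)).2).2 a ha) ξ hξ
      exact ⟨i0, fun _ => hi0⟩
    · exact ⟨0, fun h => absurd h ha⟩
  choose i1 hi1 using s1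
  choose i2 hi2 using s2
  set F : ℕ → Finset ℕ := fun a => (Finset.range p).filter
      (fun i => aeval ξ (sec p i (A a)) ≠ aeval ξ (sec p (i1 a) (A a))) with hF
  set F' : ℕ → Finset ℕ := fun a => (Finset.range p).filter
      (fun i => aeval ξ (sec p i (B a)) ≠ aeval ξ (sec p (i2 a) (B a))) with hF'
  set S := (Finset.range d).biUnion F ∪ (Finset.range d').biUnion F' with hS
  have hcard : 2 * 16 ^ (S.card + 1) < p :=
    card_union_bound F F' hi1 hi2 (by rw [← hdd]; exact hbig)
  have hSr : S ⊆ Finset.range p := by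
    intro i hi
    rw [hS, Finset.mem_union, Finset.mem_biUnion, Finset.mem_biUnion] at hi
    rcases hi with ⟨a, -, ha⟩ | ⟨a, -, ha⟩ <;> exact (Finset.mem_filter.1 ha).1
  have hξ0 : ξ ≠ 0 := hξ.ne_zero hM.ne'
  obtain ⟨k, hk0, hkp, hke, g, g', hg⟩ := core hP hsep heven p d d' e hdd hd hd'
    (fun η a => aeval (ξ * η) (A a)) (fun η a => aeval (ξ * η) (B a)) {η | η ≠ 1}
    (fun η _ h => h) (ξ ^ e) (pow_ne_zero _ hξ0)
    (fun η h1 h2 => by rw [← mul_pow]; exact (hfac _ (hmul ξ η hξ h2 h1)).2)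
    S (fun a i => aeval ξ (sec p i (A a)) - aeval ξ (sec p (i1 a) (A a)))
    (fun a i => aeval ξ (sec p i (B a)) - aeval ξ (sec p (i2 a) (B a)))
    (fun η h1 h2 a ha => by
      rw [aeval_mul_eq hp0 _ _ h2]
      refine sum_reduce hp0 h2 h1 _ _ S hSr fun i hi h3 => ?_
      exact Finset.mem_union_left _ (Finset.mem_biUnion.2 ⟨a, Finset.mem_range.2 ha,
        Finset.mem_filter.2 ⟨hi, h3⟩⟩))
    (fun η h1 h2 a ha => by
      rw [aeval_mul_eq hp0 _ _ h2]
      refine sum_reduce hp0 h2 h1 _ _ S hSr fun i hi h3 => ?_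
      exact Finset.mem_union_right _ (Finset.mem_biUnion.2 ⟨a, Finset.mem_range.2 ha,
        Finset.mem_filter.2 ⟨hi, h3⟩⟩))
    hcard
  have hkc : k.Coprime p := ((Nat.Prime.coprime_iff_not_dvd hp).2
    fun h => absurd (Nat.le_of_dvd hk0 h) (by omega)).symm
  have hpe : p ∣ e := (Nat.Coprime.dvd_mul_left hkc.symm).1 hke
  have hg2 : ∀ η : ℂ, η ^ p = 1 → η ≠ 1 → spec (fun a => aeval (ξ * η) (A a)) d = g ∧
      spec (fun a => aeval (ξ * η) (B a)) d' = g' := by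
    intro η h1 h2
    obtain ⟨m, -, hm⟩ := Nat.exists_mul_mod_eq_one_of_coprime hkc hp.one_lt
    have h3 : (η ^ m) ^ k = η := by
      rw [← pow_mul, mul_comm]
      conv_lhs => rw [← Nat.div_add_mod (k * m) p, hm, pow_add, pow_mul, h1, one_pow]
      simp
    have h4 := hg (η ^ m) (by rw [← pow_mul, mul_comm, pow_mul, h1, one_pow]) (by rw [h3]; exact h2)
    rw [h3] at h4; exact h4
  obtain ⟨η0, hη0⟩ : ∃ η0 : ℂ, IsPrimitiveRoot η0 p := ⟨_, Complex.isPrimitiveRoot_exp p hp0.ne'⟩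
  have hη1 : η0 ≠ 1 := hη0.ne_one hp.one_lt
  have hpow : (ξ * η0) ^ e = ξ ^ e := by
    obtain ⟨r, rfl⟩ := hpe
    rw [mul_pow, pow_mul η0, hη0.pow_eq_one, one_pow, mul_one]
  have hf := hfac _ (hmul ξ η0 hξ hη0.pow_eq_one hη1)
  rw [hpow] at hf
  refine ⟨hf.1, ?_⟩
  rw [← hf.2]
  congr 1
  · refine spec_congr fun a ha => ?_
    rw [map_sub]
    symm
    refine const_lemma hp.two_le (fun i => aeval ξ (sec p i (A a))) _ fun η h1 h2 => ?_
    rw [← aeval_mul_eq hp0 _ _ h1]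
    have := congrArg (fun f => coeff f a)
      ((hg2 η h1 h2).1.trans (hg2 η0 hη0.pow_eq_one hη1).1.symm)
    simpa only [spec_coeff _ _ _ ha] using this
  · refine spec_congr fun a ha => ?_
    rw [map_sub]
    symm
    refine const_lemma hp.two_le (fun i => aeval ξ (sec p i (B a))) _ fun η h1 h2 => ?_
    rw [← aeval_mul_eq hp0 _ _ h1]
    have := congrArg (fun f => coeff f a)
      ((hg2 η h1 h2).2.trans (hg2 η0 hη0.pow_eq_one hη1).2.symm)
    simpa only [spec_coeff _ _ _ ha] using this


lemma prim_mul_pow {M p b : ℕ} (hp : p.Prime) (hM : 0 < M) (hdvd : p ^ b ∣ M) (hb : 0 < b) {ζ η : ℂ}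
    (hζ : IsPrimitiveRoot ζ (M * p)) (hη : η ^ (p ^ b) = 1) : IsPrimitiveRoot (ζ * η) (M * p) := by
  obtain ⟨m, rfl⟩ := hdvd
  have hMp : 0 < p ^ b * m * p := Nat.mul_pos hM hp.pos
  have h1 : IsPrimitiveRoot (ζ ^ (m * p)) (p ^ b) :=
    hζ.pow hMp (by ring)
  haveI : NeZero (p ^ b) := ⟨(pow_pos hp.pos b).ne'⟩
  obtain ⟨i, -, hi⟩ := h1.eq_pow_of_pow_eq_one hη
  rw [← hi, ← pow_mul, ← pow_succ']
  refine hζ.pow_of_coprime _ ?_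
  have c1 : (m * p * i + 1).Coprime (m * p) := by
    exact (Nat.coprime_mul_left_add_left 1 (m * p) i).2 (Nat.coprime_one_left _) 
  have c2 : (m * p * i + 1).Coprime p := Nat.Coprime.coprime_dvd_right (dvd_mul_left p m) c1
  rw [mul_assoc (p ^ b) m p]
  exact Nat.Coprime.mul_right (Nat.Coprime.pow_right b c2) c1

lemma sec_zero_contract {p : ℕ} (hp : p ≠ 0) (A : ℤ[X]) : sec p 0 A = expand ℤ p (contract p A) := by
  ext n
  rw [coeff_expand (Nat.pos_of_ne_zero hp), sec, finsetSum_coeff]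
  simp only [coeff_C_mul, coeff_X_pow, mul_ite, mul_one, mul_zero]
  rw [Finset.sum_ite_eq, coeff_contract hp]
  simp only [Finset.mem_filter, mem_support_iff]
  by_cases h : p ∣ n
  · rw [if_pos h, Nat.div_mul_cancel h]
    have := Nat.mod_eq_zero_of_dvd h
    split_ifs with h1
    · rfl
    · by_contra h2; exact h1 ⟨Ne.symm h2, this⟩
  · rw [if_neg h, if_neg]
    rintro ⟨-, h1⟩; exact h (Nat.dvd_of_mod_eq_zero h1)

lemma prim_root_up {M p : ℕ} (hp : p.Prime) (hpM : p ∣ M) {ξ ζ : ℂ} (hξ : IsPrimitiveRoot ξ M)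
    (h : ζ ^ p = ξ) : IsPrimitiveRoot ζ (M * p) := by
  constructor
  · rw [mul_comm, pow_mul, h, hξ.pow_eq_one]
  · intro l hl
    have h1 : ξ ^ l = 1 := by rw [← h, ← pow_mul, mul_comm, pow_mul, hl, one_pow]
    obtain ⟨l', rfl⟩ := hpM.trans (hξ.dvd_of_pow_eq_one l h1)
    rw [pow_mul, h] at hl
    rw [mul_comm M p]
    exact Nat.mul_dvd_mul_left p (hξ.dvd_of_pow_eq_one _ hl)

lemma descent2 {P : ℂ[X]} (hP : P.Monic) (hsep : P.roots.Nodup) (heven : Even P.natDegree)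
    {B0 : ℝ} (hH : House P B0) {N M p b : ℕ} (hp : p.Prime) (hM : 0 < M) (hb : 0 < b)
    (hdvd : p ^ b ∣ M)
    (hbig : 2 * 16 ^ ((P.natDegree + 1) * ⌊2 * B0 ^ 2⌋₊ + 1) < p ^ b) (h : Fac P N (M * p)) :
    Fac P N M := by
  obtain ⟨e, d, d', A, B, hd, hd', hdd, hfac⟩ := h
  have hp0 := hp.pos
  have hq0 : 0 < p ^ b := pow_pos hp0 b
  have hMp : 0 < M * p := Nat.mul_pos hM hp0
  have hpM : p ∣ M := (dvd_pow_self p hb.ne').trans hdvd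
  refine ⟨e / p, d, d', fun a => contract p (A a), fun a => contract p (B a),
    hd, hd', hdd, fun ξ' hξ' => ?_⟩
  obtain ⟨ξ, hξξ'⟩ := IsAlgClosed.exists_pow_nat_eq ξ' hp0
  have hξ : IsPrimitiveRoot ξ (M * p) := prim_root_up hp hpM hξ' hξξ'
  have hmul := fun (ζ η : ℂ) (h1 : IsPrimitiveRoot ζ (M * p)) (h2 : η ^ (p ^ b) = 1) =>
    prim_mul_pow hp hM hdvd hb h1 h2
  have hBB : B0 ^ 2 ≤ 2 * B0 ^ 2 := by nlinarith [sq_nonneg B0]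
  set F : ℕ → Finset ℕ := fun a => (Finset.range (p ^ b)).filter
      (fun i => aeval ξ (sec (p ^ b) i (A a)) ≠ 0) with hF
  set F' : ℕ → Finset ℕ := fun a => (Finset.range (p ^ b)).filter
      (fun i => aeval ξ (sec (p ^ b) i (B a)) ≠ 0) with hF'
  have s1 : ∀ a < d, ((F a).card : ℝ) ≤ 2 * B0 ^ 2 := fun a ha =>
    (support2 hMp hq0 hmul (A a) (fun ζ h1 =>
        (Fac_house hH hdd hMp h1 (hfac _ h1).2).1 a ha) ξ hξ).trans hBB
  have s2 : ∀ a < d', ((F' a).card : ℝ) ≤ 2 * B0 ^ 2 := fun a ha =>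
    (support2 hMp hq0 hmul (B a) (fun ζ h1 =>
        (Fac_house hH hdd hMp h1 (hfac _ h1).2).2 a ha) ξ hξ).trans hBB
  set S := (Finset.range d).biUnion F ∪ (Finset.range d').biUnion F' with hS
  have hcard : 2 * 16 ^ (S.card + 1) < p ^ b :=
    card_union_bound F F' s1 s2 (by rw [← hdd]; exact hbig)
  have hSr : S ⊆ Finset.range (p ^ b) := by
    intro i hi
    rw [hS, Finset.mem_union, Finset.mem_biUnion, Finset.mem_biUnion] at hi
    rcases hi with ⟨a, -, ha⟩ | ⟨a, -, ha⟩ <;> exact (Finset.mem_filter.1 ha).1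
  have hξ0 : ξ ≠ 0 := hξ.ne_zero hMp.ne'
  obtain ⟨k, hk0, hkp, hke, g, g', hg⟩ := core hP hsep heven (p ^ b) d d' e hdd hd hd'
    (fun η a => aeval (ξ * η) (A a)) (fun η a => aeval (ξ * η) (B a)) Set.univ
    (fun η _ h => trivial) (ξ ^ e) (pow_ne_zero _ hξ0)
    (fun η h1 h2 => by rw [← mul_pow]; exact (hfac _ (hmul ξ η hξ h2)).2)
    S (fun a i => aeval ξ (sec (p ^ b) i (A a)))
    (fun a i => aeval ξ (sec (p ^ b) i (B a)))
    (fun η h1 h2 a ha => by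
      rw [aeval_mul_eq hq0 _ _ h2]
      symm
      refine Finset.sum_subset hSr fun i hi hiS => ?_
      have : aeval ξ (sec (p ^ b) i (A a)) = 0 := by
        by_contra h3
        exact hiS (Finset.mem_union_left _ (Finset.mem_biUnion.2 ⟨a, Finset.mem_range.2 ha,
          Finset.mem_filter.2 ⟨hi, h3⟩⟩))
      rw [this, zero_mul])
    (fun η h1 h2 a ha => by
      rw [aeval_mul_eq hq0 _ _ h2]
      symm
      refine Finset.sum_subset hSr fun i hi hiS => ?_
      have : aeval ξ (sec (p ^ b) i (B a)) = 0 := by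
        by_contra h3
        exact hiS (Finset.mem_union_right _ (Finset.mem_biUnion.2 ⟨a, Finset.mem_range.2 ha,
          Finset.mem_filter.2 ⟨hi, h3⟩⟩))
      rw [this, zero_mul])
    hcard
  obtain ⟨η0, hη0⟩ : ∃ η0 : ℂ, IsPrimitiveRoot η0 (p ^ b) :=
    ⟨_, Complex.isPrimitiveRoot_exp (p ^ b) hq0.ne'⟩
  -- an element of order `p` which is a `k`-th power
  obtain ⟨θ, hθq, hθ⟩ : ∃ θ : ℂ, θ ^ (p ^ b) = 1 ∧ IsPrimitiveRoot (θ ^ k) p ∧ (θ ^ k) ^ e = 1 := by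
    have o1 : orderOf (η0 ^ k) ∣ p ^ b := orderOf_dvd_of_pow_eq_one (pow_range_of_prim hη0 k)
    obtain ⟨j, hj, ho⟩ := (Nat.dvd_prime_pow hp).1 o1
    have hj0 : j ≠ 0 := by
      rintro rfl
      rw [pow_zero, orderOf_eq_one_iff] at ho
      exact hη0.pow_ne_one_of_pos_of_lt hk0.ne' hkp ho
    obtain ⟨j, rfl⟩ := Nat.exists_eq_succ_of_ne_zero hj0
    refine ⟨η0 ^ (p ^ j), pow_range_of_prim hη0 _, ?_, ?_⟩
    · have h1 : IsPrimitiveRoot (η0 ^ k) (p ^ (j + 1)) := by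
        rw [← Nat.succ_eq_add_one, ← ho]; exact IsPrimitiveRoot.orderOf _
      have h2 := h1.pow (pow_pos hp0 _) (pow_succ p j)
      rwa [← pow_mul, mul_comm, pow_mul] at h2
    · obtain ⟨c, hc⟩ := hke
      rw [← pow_mul, ← pow_mul, hc, mul_comm, mul_assoc, pow_mul, hη0.pow_eq_one, one_pow]
  have hpe : p ∣ e := hθ.1.dvd_of_pow_eq_one _ hθ.2
  have hg2 : ∀ η : ℂ, η ^ p = 1 → spec (fun a => aeval (ξ * η) (A a)) d = g ∧
      spec (fun a => aeval (ξ * η) (B a)) d' = g' := by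
    intro η h1
    haveI : NeZero p := ⟨hp0.ne'⟩
    obtain ⟨m, -, hm⟩ := hθ.1.eq_pow_of_pow_eq_one h1
    have h3 : (θ ^ m) ^ k = η := by
      rw [← pow_mul, mul_comm, pow_mul, hm]
    have h4 := hg (θ ^ m) (by rw [← pow_mul, mul_comm, pow_mul, hθq, one_pow]) trivial
    rw [h3] at h4; exact h4
  have hpow : ξ ^ e = ξ' ^ (e / p) := by
    rw [← hξξ', ← pow_mul, Nat.mul_div_cancel' hpe]
  have hf := hfac _ hξ
  rw [hpow] at hf
  refine ⟨hf.1, ?_⟩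
  rw [← hf.2]
  have hg1 := hg2 1 (one_pow _)
  rw [mul_one] at hg1
  congr 1
  · refine spec_congr fun a ha => ?_
    rw [← hξξ', ← expand_aeval, ← sec_zero_contract hp0.ne']
    symm
    refine const_lemma2 hp0 (fun i => aeval ξ (sec p i (A a))) _ fun η h1 => ?_
    rw [← aeval_mul_eq hp0 _ _ h1]
    have := congrArg (fun f => coeff f a) ((hg2 η h1).1.trans hg1.1.symm)
    simpa only [spec_coeff _ _ _ ha] using this
  · refine spec_congr fun a ha => ?_
    rw [← hξξ', ← expand_aeval, ← sec_zero_contract hp0.ne']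
    symm
    refine const_lemma2 hp0 (fun i => aeval ξ (sec p i (B a))) _ fun η h1 => ?_
    rw [← aeval_mul_eq hp0 _ _ h1]
    have := congrArg (fun f => coeff f a) ((hg2 η h1).2.trans hg1.2.symm)
    simpa only [spec_coeff _ _ _ ha] using this

lemma descent {P : ℂ[X]} (hP : P.Monic) (hsep : P.roots.Nodup) (heven : Even P.natDegree)
    (hPd : 0 < P.natDegree) : ∃ K : ℕ, ∀ N M : ℕ, 0 < M → Fac P N M → N ≤ K := by
  obtain ⟨B0, -, hH⟩ := house hPd
  change House P B0 at hH
  set Q := 2 * 16 ^ ((P.natDegree + 1) * ⌊2 * B0 ^ 2⌋₊ + 1) with hQ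
  refine ⟨(Q ^ 2).factorial, fun N M => ?_⟩
  have hQ0 : 0 < Q := by positivity
  induction M using Nat.strong_induction_on with
  | _ M ih =>
  intro hM hF
  by_cases hd : M ∣ (Q ^ 2).factorial
  · obtain ⟨e, d, d', A, B, -, -, -, hfac⟩ := hF
    obtain ⟨z, hz⟩ : ∃ z : ℂ, IsPrimitiveRoot z M := ⟨_, Complex.isPrimitiveRoot_exp M hM.ne'⟩
    have h1 := (hfac _ hz).1
    have h2 := h1.dvd_of_pow_eq_one M (by rw [← pow_mul, mul_comm, pow_mul, hz.pow_eq_one, one_pow])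
    exact Nat.le_of_dvd (Nat.factorial_pos _) (h2.trans hd)
  · rw [Nat.dvd_iff_prime_pow_dvd_dvd] at hd
    push Not at hd
    obtain ⟨p, k, hp, h1, h2⟩ := hd
    have hpk : Q ^ 2 < p ^ k := by
      by_contra! h3
      exact h2 (Nat.dvd_factorial (pow_pos hp.pos k) h3)
    have h1' : p ^ k ≤ p ^ (M.factorization p) :=
      Nat.pow_le_pow_right hp.pos ((hp.pow_dvd_iff_le_factorization hM.ne').1 h1)
    have hlt := hpk.trans_le h1'
    have hdv : p ^ (M.factorization p) ∣ M := Nat.ordProj_dvd M p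
    obtain ⟨m, hm⟩ := hdv
    have hcop : p.Coprime m := by
      have := Nat.coprime_ordCompl hp hM.ne'
      have h5 : M / p ^ (M.factorization p) = m :=
        Nat.div_eq_of_eq_mul_right (pow_pos hp.pos _) hm
      rwa [h5] at this
    generalize M.factorization p = c at *
    have hm0 : 0 < m := by
      rcases Nat.eq_zero_or_pos m with h | h
      · subst h; omega
      · exact h
    match c with
    | 0 => 
      have := Nat.one_le_pow 2 Q hQ0
      rw [pow_zero] at hlt; omega
    | 1 =>
      rw [pow_one] at hm hlt
      refine ih m ?_ hm0 (descent1 hP hsep heven hH hp hm0 hcop.symm ?_ (by rwa [mul_comm, ← hm]))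
      · rw [hm]; nlinarith [hp.two_le]
      · exact lt_of_le_of_lt (Nat.le_self_pow two_ne_zero Q) hlt
    | b + 2 =>
      have hM2 : M = (p ^ (b + 1) * m) * p := by rw [hm]; ring
      have hpos : 0 < p ^ (b + 1) * m := Nat.mul_pos (pow_pos hp.pos _) hm0
      refine ih (p ^ (b + 1) * m) ?_ hpos (descent2 (b := b + 1) hP hsep heven hH hp hpos
        (by omega) (Dvd.intro _ rfl) ?_ (by rwa [← hM2]))
      · rw [hM2]; nlinarith [hp.two_le]
      · have h6 : p ^ (b + 2) ≤ (p ^ (b + 1)) ^ 2 := by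
          rw [← pow_mul]; exact Nat.pow_le_pow_right hp.pos (by omega)
        exact lt_of_pow_lt_pow_left₀ 2 (by positivity) (hlt.trans_le h6)


lemma coeff_integral {P0 : ℤ[X]} (hP : P0.Monic) {y : ℂ} (hy : IsIntegral ℤ y) {g : ℂ[X]}
    (hg : g.Monic) (hd : g ∣ P0.map (Int.castRingHom ℂ) * (X - C y) - 1) (a : ℕ) :
    IsIntegral ℤ (g.coeff a) := by
  let R := integralClosure ℤ ℂ
  let y0 : R := ⟨y, hy⟩
  let F0 : R[X] := P0.map (Int.castRingHom R) * (X - C y0) - 1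
  have hmon : (P0.map (Int.castRingHom R) * (X - C y0)).Monic :=
    (hP.map _).mul (monic_X_sub_C _)
  have hF0 : F0.Monic := by
    refine hmon.sub_of_left ?_
    rw [degree_one, (monic_X_sub_C y0).degree_mul, degree_X_sub_C, degree_eq_natDegree (hP.map _).ne_zero]
    exact_mod_cast Nat.succ_pos _
  have hmap : F0.map (algebraMap R ℂ) = P0.map (Int.castRingHom ℂ) * (X - C y) - 1 := by
    simp only [F0, Polynomial.map_sub, Polynomial.map_mul, Polynomial.map_one, map_X, map_C,
      Polynomial.map_map]
    congr 3
  have h1 := integralClosure.mem_lifts_of_monic_of_dvd_map ℂ hF0 hg (by rw [hmap]; exact hd)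
  rw [lifts_iff_coeff_lifts] at h1
  obtain ⟨z, hz⟩ := h1 a
  rw [← hz]
  have h2 : IsIntegral R (z : ℂ) := z.2
  exact isIntegral_trans (A := R) _ h2

noncomputable def xi (M : ℕ) : ℂ := Complex.exp (2 * Real.pi * I / M)

lemma xi_prim {M : ℕ} (hM : 0 < M) : IsPrimitiveRoot (xi M) M := Complex.isPrimitiveRoot_exp M hM.ne'

lemma xi_pow {M m : ℕ} (hM : 0 < M) (hm : 0 < m) : xi (M * m) ^ m = xi M := by
  rw [xi, xi, ← Complex.exp_nat_mul]
  congr 1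
  have h1 : (M : ℂ) ≠ 0 := by exact_mod_cast hM.ne'
  have h2 : (m : ℂ) ≠ 0 := by exact_mod_cast hm.ne'
  push_cast
  field_simp

open IntermediateField in
lemma E_mono {M m : ℕ} (hM : 0 < M) (hm : 0 < m) :
    (adjoin ℚ {xi M} : IntermediateField ℚ ℂ) ≤ adjoin ℚ {xi (M * m)} := by
  rw [adjoin_simple_le_iff, ← xi_pow hM hm]
  exact pow_mem (mem_adjoin_simple_self ℚ _) _

open IntermediateField in
lemma mem_E {x : ℂ} (hx : x ∈ (adjoin ℚ {z : ℂ | ∃ n : ℕ, 0 < n ∧ z ^ n = 1} : IntermediateField ℚ ℂ)) :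
    ∃ M : ℕ, 0 < M ∧ x ∈ (adjoin ℚ {xi M} : IntermediateField ℚ ℂ) := by
  have comb : ∀ {M M' : ℕ}, 0 < M → 0 < M' →
      (adjoin ℚ {xi M} : IntermediateField ℚ ℂ) ≤ adjoin ℚ {xi (M * M')} ∧
      (adjoin ℚ {xi M'} : IntermediateField ℚ ℂ) ≤ adjoin ℚ {xi (M * M')} := by
    intro M M' h h'
    refine ⟨E_mono h h', ?_⟩
    rw [mul_comm M M']; exact E_mono h' h
  induction hx using adjoin_induction with
  | mem x hx =>
    obtain ⟨n, hn, hxn⟩ := hx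
    have : NeZero n := ⟨hn.ne'⟩
    obtain ⟨i, -, hi⟩ := (xi_prim hn).eq_pow_of_pow_eq_one hxn
    refine ⟨n, hn, ?_⟩
    rw [← hi]; exact pow_mem (mem_adjoin_simple_self ℚ _) _
  | algebraMap x => exact ⟨1, one_pos, IntermediateField.algebraMap_mem _ x⟩
  | add x y _ _ h1 h2 =>
    obtain ⟨M, hM, h1⟩ := h1
    obtain ⟨M', hM', h2⟩ := h2
    exact ⟨M * M', Nat.mul_pos hM hM', add_mem ((comb hM hM').1 h1) ((comb hM hM').2 h2)⟩
  | inv x _ h1 =>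
    obtain ⟨M, hM, h1⟩ := h1
    exact ⟨M, hM, inv_mem h1⟩
  | mul x y _ _ h1 h2 =>
    obtain ⟨M, hM, h1⟩ := h1
    obtain ⟨M', hM', h2⟩ := h2
    exact ⟨M * M', Nat.mul_pos hM hM', mul_mem ((comb hM hM').1 h1) ((comb hM hM').2 h2)⟩

open IntermediateField in
lemma mem_E_finset {n : ℕ} (hn : 0 < n) (s : Finset ℂ) (hs : ∀ x ∈ s,
      x ∈ (adjoin ℚ {z : ℂ | ∃ n : ℕ, 0 < n ∧ z ^ n = 1} : IntermediateField ℚ ℂ)) :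
    ∃ m : ℕ, 0 < m ∧ ∀ x ∈ s, x ∈ (adjoin ℚ {xi (n * m)} : IntermediateField ℚ ℂ) := by
  classical
  induction s using Finset.induction_on with
  | empty => exact ⟨1, one_pos, by simp⟩
  | insert a s _ ih =>
    obtain ⟨m, hm, h1⟩ := ih fun x hx => hs x (Finset.mem_insert_of_mem hx)
    obtain ⟨M, hM, h2⟩ := mem_E (hs a (Finset.mem_insert_self _ _))
    refine ⟨m * M, Nat.mul_pos hm hM, fun x hx => ?_⟩
    rw [← mul_assoc]
    rcases Finset.mem_insert.1 hx with rfl | hx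
    · rw [mul_comm (n * m) M]
      exact E_mono hM (Nat.mul_pos hn hm) h2
    · exact E_mono (Nat.mul_pos hn hm) hM (h1 x hx)

open IntermediateField in
lemma integral_E {M : ℕ} (hM : 0 < M) {x : ℂ}
    (hx : x ∈ (adjoin ℚ {xi M} : IntermediateField ℚ ℂ)) (hi : IsIntegral ℤ x) :
    ∃ A : ℤ[X], aeval (xi M) A = x := by
  have : NeZero M := ⟨hM.ne'⟩
  let K : IntermediateField ℚ ℂ := adjoin ℚ {xi M}
  have hξ := xi_prim hM
  have hcyc : IsCyclotomicExtension {M} ℚ K := by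
    have halg : IsAlgebraic ℚ (xi M) := ((hξ.isIntegral hM).tower_top (A := ℚ)).isAlgebraic
    change IsCyclotomicExtension {M} ℚ K.toSubalgebra
    rw [IntermediateField.adjoin_simple_toSubalgebra_of_isAlgebraic halg]
    exact hξ.adjoin_isCyclotomicExtension ℚ
  let z : K := AdjoinSimple.gen ℚ (xi M)
  have hzc : (z : ℂ) = xi M := AdjoinSimple.coe_gen ℚ (xi M)
  have hz : IsPrimitiveRoot z M := by
    rw [← hzc] at hξ
    exact (IsPrimitiveRoot.map_iff_of_injective (f := algebraMap K ℂ)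
      (algebraMap K ℂ).injective).1 hξ
  have h1 := IsCyclotomicExtension.Rat.isIntegralClosure_adjoin_singleton hz
  let x' : K := ⟨x, hx⟩
  have hx' : IsIntegral ℤ x' := by
    rw [← isIntegral_algebraMap_iff (algebraMap K ℂ).injective]; exact hi
  obtain ⟨w, hw⟩ := h1.isIntegral_iff.1 hx'
  have hw2 : x' ∈ Algebra.adjoin ℤ {z} := by rw [← hw]; exact w.2
  rw [Algebra.adjoin_singleton_eq_range_aeval] at hw2
  obtain ⟨A, hA⟩ := hw2
  refine ⟨A, ?_⟩
  have h2 := congrArg (algebraMap K ℂ) hA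
  have h3 : algebraMap K ℂ (aeval z A) = aeval (algebraMap K ℂ z) A := (aeval_algebraMap_apply ℂ z A).symm
  have h4 : algebraMap K ℂ z = xi M := hzc
  rw [← h4, ← h3]; exact h2


noncomputable def spz (A : ℕ → ℤ[X]) (d : ℕ) : ℤ[X][X] :=
  X ^ d + ∑ a ∈ Finset.range d, C (A a) * X ^ a

lemma spz_map (A : ℕ → ℤ[X]) (d : ℕ) (ζ : ℂ) :
    (spz A d).map ((aeval ζ).toRingHom : ℤ[X] →+* ℂ) = spec (fun a => aeval ζ (A a)) d := by
  simp [spz, spec, Polynomial.map_sum]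

lemma initial {P0 : ℤ[X]} (hP : P0.Monic) {n : ℕ} (hn : 0 < n) {g g' : ℂ[X]}
    (hg : g.Monic) (hg' : g'.Monic) (hd : 0 < g.natDegree) (hd' : 0 < g'.natDegree)
    (hgQ : ∀ a, g.coeff a ∈ (IntermediateField.adjoin ℚ {z : ℂ | ∃ n : ℕ, 0 < n ∧ z ^ n = 1}))
    (hgQ' : ∀ a, g'.coeff a ∈ (IntermediateField.adjoin ℚ {z : ℂ | ∃ n : ℕ, 0 < n ∧ z ^ n = 1}))
    (h : g * g' = P0.map (Int.castRingHom ℂ) * (X - C (xi n ^ 2 + (xi n ^ 2)⁻¹)) - 1) :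
    ∃ M, 0 < M ∧ Fac (P0.map (Int.castRingHom ℂ)) (orderOf (xi n ^ 2)) M := by
  classical
  set P := P0.map (Int.castRingHom ℂ) with hPdef
  have hPm : P.Monic := hP.map _
  have hdeg : P.natDegree + 1 = g.natDegree + g'.natDegree := by
    rw [← hg.natDegree_mul hg', h, natDegree_sub_eq_left_of_natDegree_lt]
    · rw [hPm.natDegree_mul (monic_X_sub_C _), natDegree_X_sub_C]
    · rw [hPm.natDegree_mul (monic_X_sub_C _), natDegree_X_sub_C]; simp
  have hxn := xi_prim hn
  have hint1 : IsIntegral ℤ (xi n) := hxn.isIntegral hn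
  have hint2 : IsIntegral ℤ (xi n)⁻¹ := hxn.inv.isIntegral hn
  have hy : IsIntegral ℤ (xi n ^ 2 + (xi n ^ 2)⁻¹) := by
    rw [← inv_pow]; exact (hint1.pow 2).add (hint2.pow 2)
  have hgi := coeff_integral hP hy hg (Dvd.intro _ h)
  have hgi' := coeff_integral hP hy hg' (Dvd.intro_left _ h)
  obtain ⟨m, hm, hE⟩ := mem_E_finset hn ((Finset.range g.natDegree).image g.coeff ∪
    (Finset.range g'.natDegree).image g'.coeff) (by
      intro x hx
      rw [Finset.mem_union, Finset.mem_image, Finset.mem_image] at hx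
      rcases hx with ⟨a, -, rfl⟩ | ⟨a, -, rfl⟩
      · exact hgQ a
      · exact hgQ' a)
  set M := n * m with hMdef
  have hM : 0 < M := Nat.mul_pos hn hm
  have hξ := xi_prim hM
  have hA : ∀ a, ∃ A : ℤ[X], a < g.natDegree → aeval (xi M) A = g.coeff a := by
    intro a
    by_cases ha : a < g.natDegree
    · obtain ⟨A, hA⟩ := integral_E hM (hE _ (Finset.mem_union_left _ (Finset.mem_image_of_mem _
        (Finset.mem_range.2 ha)))) (hgi a)
      exact ⟨A, fun _ => hA⟩
    · exact ⟨0, fun h => absurd h ha⟩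
  have hB : ∀ a, ∃ A : ℤ[X], a < g'.natDegree → aeval (xi M) A = g'.coeff a := by
    intro a
    by_cases ha : a < g'.natDegree
    · obtain ⟨A, hA⟩ := integral_E hM (hE _ (Finset.mem_union_right _ (Finset.mem_image_of_mem _
        (Finset.mem_range.2 ha)))) (hgi' a)
      exact ⟨A, fun _ => hA⟩
    · exact ⟨0, fun h => absurd h ha⟩
  choose A hA using hA
  choose B hB using hB
  set e := m * 2 with he
  have hξe : xi M ^ e = xi n ^ 2 := by rw [he, pow_mul, hMdef, xi_pow hn hm]
  have hinv : ∀ ζ : ℂ, IsPrimitiveRoot ζ M → (ζ ^ e)⁻¹ = ζ ^ ((M - 1) * e) := by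
    intro ζ hζ
    have : (M - 1) * e + e = M * e := by
      obtain ⟨k, hk⟩ := Nat.exists_eq_succ_of_ne_zero hM.ne'
      rw [hk, Nat.succ_sub_one, Nat.succ_mul]
    refine inv_eq_of_mul_eq_one_right ?_
    rw [← pow_add, add_comm, this, pow_mul, hζ.pow_eq_one, one_pow]
  refine ⟨M, hM, e, g.natDegree, g'.natDegree, A, B, hd, hd', hdeg, fun ζ hζ => ⟨?_, ?_⟩⟩
  · rw [← hξe]
    have key : ∀ l, (ζ ^ e) ^ l = 1 ↔ (xi M ^ e) ^ l = 1 := fun l => by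
      rw [← pow_mul, ← pow_mul, hζ.pow_eq_one_iff_dvd, hξ.pow_eq_one_iff_dvd]
    exact ⟨(key _).2 (pow_orderOf_eq_one _), fun l hl => orderOf_dvd_of_pow_eq_one ((key l).1 hl)⟩
  · let D : ℤ[X][X] := spz A g.natDegree * spz B g'.natDegree -
      (P0.map C * (X - C (X ^ e + X ^ ((M - 1) * e))) - 1)
    have hD : ∀ z : ℂ, IsPrimitiveRoot z M → D.map ((aeval z).toRingHom : ℤ[X] →+* ℂ) =
        spec (fun a => aeval z (A a)) g.natDegree * spec (fun a => aeval z (B a)) g'.natDegree -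
          (P * (X - C (z ^ e + (z ^ e)⁻¹)) - 1) := by
      intro z hz
      simp only [D, Polynomial.map_sub, Polynomial.map_mul, spz_map, Polynomial.map_map,
        Polynomial.map_one, map_X, map_C]
      rw [hinv z hz]
      have : (((aeval z).toRingHom : ℤ[X] →+* ℂ).comp C) = Int.castRingHom ℂ := RingHom.ext_int _ _
      rw [this, ← hPdef]
      simp
    have h0 : D.map ((aeval (xi M)).toRingHom : ℤ[X] →+* ℂ) = 0 := by
      rw [hD _ hξ, hξe, ← h, spec_congr (γ' := g.coeff) fun a ha => hA a ha,
        spec_congr (γ' := g'.coeff) fun a ha => hB a ha, ← spec_eq_of_monic hg,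
        ← spec_eq_of_monic hg', sub_self]
    have h1 : D.map ((aeval ζ).toRingHom : ℤ[X] →+* ℂ) = 0 := by
      ext j
      have h2 := congrArg (fun f => coeff f j) h0
      simp only [coeff_map, coeff_zero] at h2 ⊢
      exact prim_transfer hM hξ hζ h2
    rw [hD _ hζ, sub_eq_zero] at h1
    exact h1

section sigma
variable {σ : ℤ → ℤ[X]} 

lemma sig_monic (h0 : σ 0 = 0) (h1 : σ 1 = 1) (h : ∀ i : ℤ, σ (i + 1) = X * σ i - σ (i - 1)) (k : ℕ) :
    (σ (k + 1)).Monic ∧ (σ (k + 1)).natDegree = k ∧ (σ k).degree < k := by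
  induction k with
  | zero => simp [h0, h1]
  | succ k ih =>
    obtain ⟨a, b, c⟩ := ih
    have hdeg : (σ (k + 1)).degree = k := by rw [degree_eq_natDegree a.ne_zero, b]
    have e1 : σ ((k + 1 : ℕ) + 1) = X * σ (k + 1) - σ k := by
      have := h (k + 1); rw [add_sub_cancel_right] at this; push_cast; exact this
    have hm : (X * σ (k + 1)).Monic := monic_X.mul a
    have hd : (X * σ (k + 1)).degree = ((k + 1 : ℕ) : WithBot ℕ) := by
      rw [a.degree_mul, degree_X, hdeg]; push_cast; rw [add_comm]
    have hlt : (σ k).degree < (X * σ (k + 1)).degree := by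
      rw [hd]; exact c.trans (by exact_mod_cast Nat.lt_succ_self k)
    rw [e1]
    refine ⟨hm.sub_of_left hlt, ?_, ?_⟩
    · apply natDegree_eq_of_degree_eq_some
      rw [degree_sub_eq_left_of_degree_lt hlt, hd]
    · push_cast; rw [hdeg]; exact_mod_cast Nat.lt_succ_self k

lemma sig_neg (h0 : σ 0 = 0) (h : ∀ i : ℤ, σ (i + 1) = X * σ i - σ (i - 1)) (k : ℕ) :
    σ (-(k : ℤ)) = - σ k ∧ σ (-((k : ℤ) + 1)) = - σ (k + 1) := by
  induction k with
  | zero =>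
    have := h 0
    simp [h0] at this
    simp [h0, this]
  | succ k ih =>
    refine ⟨by push_cast; exact ih.2, ?_⟩
    have a1 := h (k + 1)
    have a2 := h (-((k : ℤ) + 1))
    rw [add_sub_cancel_right] at a1
    rw [show -((k : ℤ) + 1) + 1 = -k by ring, ih.1, ih.2,
      show -((k : ℤ) + 1) - 1 = -(((k + 1 : ℕ) : ℤ) + 1) by push_cast; ring] at a2
    push_cast at a2 ⊢
    rw [a1]
    linear_combination a2

lemma sig_sin (h0 : σ 0 = 0) (h1 : σ 1 = 1) (h : ∀ i : ℤ, σ (i + 1) = X * σ i - σ (i - 1)) (θ : ℝ) (k : ℕ) :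
    aeval (2 * Real.cos θ) (σ k) * Real.sin θ = Real.sin (k * θ) ∧
    aeval (2 * Real.cos θ) (σ (k + 1)) * Real.sin θ = Real.sin ((k + 1 : ℝ) * θ) := by
  induction k with
  | zero => simp [h0, h1]
  | succ k ih =>
    refine ⟨by push_cast; exact ih.2, ?_⟩
    have a1 := h (k + 1)
    rw [add_sub_cancel_right] at a1
    push_cast
    rw [a1, map_sub, map_mul, aeval_X, sub_mul, mul_assoc, ih.1, ih.2]
    have e1 : ((k : ℝ) + 1 + 1) * θ = (k + 1) * θ + θ := by ring
    have e2 : (k : ℝ) * θ = (k + 1) * θ - θ := by ring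
    rw [e1, e2, Real.sin_add, Real.sin_sub]; ring
end sigma


section sigma2
variable {σ : ℤ → ℤ[X]}

lemma P0_monic (h0 : σ 0 = 0) (h1 : σ 1 = 1) (h : ∀ i : ℤ, σ (i + 1) = X * σ i - σ (i - 1)) (k : ℕ) :
    (σ (k + 1) * (σ (k + 1) - σ k)).Monic ∧ (σ (k + 1) * (σ (k + 1) - σ k)).natDegree = 2 * k := by
  obtain ⟨a, b, c⟩ := sig_monic h0 h1 h k
  have hdeg : (σ (k + 1)).degree = k := by rw [degree_eq_natDegree a.ne_zero, b]
  have hlt : (σ k).degree < (σ (k + 1)).degree := by rw [hdeg]; exact c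
  have hm : (σ (k + 1) - σ k).Monic := a.sub_of_left hlt
  refine ⟨a.mul hm, ?_⟩
  rw [a.natDegree_mul hm, b]
  have : (σ (k + 1) - σ k).natDegree = k := by
    apply natDegree_eq_of_degree_eq_some
    rw [degree_sub_eq_left_of_degree_lt hlt, hdeg]
  omega

lemma P0_nodup (h0 : σ 0 = 0) (h1 : σ 1 = 1) (h : ∀ i : ℤ, σ (i + 1) = X * σ i - σ (i - 1)) (k : ℕ) :
    ((σ (k + 1) * (σ (k + 1) - σ k)).map (Int.castRingHom ℂ)).roots.Nodup := by
  classical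
  obtain ⟨hm, hd⟩ := P0_monic h0 h1 h k
  set P0 := σ (k + 1) * (σ (k + 1) - σ k) with hP0
  let D : ℝ := (k + 1) * (2 * k + 1)
  have hD : 0 < D := by positivity
  let S1 : Finset ℕ := (Finset.range k).image (fun j => (j + 1) * (2 * k + 1))
  let S2 : Finset ℕ := (Finset.range k).image (fun j => (2 * j + 1) * (k + 1))
  have c1 : S1.card = k := by
    rw [Finset.card_image_of_injective, Finset.card_range]
    intro a b hab
    have := Nat.eq_of_mul_eq_mul_right (by omega) hab
    omega
  have c2 : S2.card = k := by
    rw [Finset.card_image_of_injective, Finset.card_range]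
    intro a b hab
    have := Nat.eq_of_mul_eq_mul_right (by omega) hab
    omega
  have hdisj : Disjoint S1 S2 := by
    rw [Finset.disjoint_left]
    intro x hx hx'
    simp only [S1, S2, Finset.mem_image, Finset.mem_range] at hx hx'
    obtain ⟨a, ha, rfl⟩ := hx
    obtain ⟨b, hb, hab⟩ := hx'
    have hcop : Nat.Coprime (k + 1) (2 * k + 1) := by
      have : 2 * k + 1 = k + (k + 1) := by ring
      rw [this]; simp
    have hdv : (k + 1) ∣ (a + 1) * (2 * k + 1) := ⟨2 * b + 1, by rw [← hab]; ring⟩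
    have := Nat.le_of_dvd (by omega) (hcop.dvd_of_dvd_mul_right hdv)
    omega
  let S := S1 ∪ S2
  have cS : S.card = 2 * k := by
    rw [Finset.card_union_of_disjoint hdisj, c1, c2]; ring
  let θ : ℕ → ℝ := fun s => Real.pi * s / D
  have hpi := Real.pi_pos
  have hSb : ∀ s ∈ S, 0 < s ∧ (s : ℝ) < D := by
    intro s hs
    rcases Finset.mem_union.1 hs with hs | hs
    · simp only [S1, Finset.mem_image, Finset.mem_range] at hs
      obtain ⟨a, ha, rfl⟩ := hs
      refine ⟨by positivity, ?_⟩
      have : (a : ℝ) + 1 ≤ k := by exact_mod_cast ha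
      simp only [D]; push_cast
      have : (0:ℝ) < 2 * k + 1 := by positivity
      nlinarith
    · simp only [S2, Finset.mem_image, Finset.mem_range] at hs
      obtain ⟨a, ha, rfl⟩ := hs
      refine ⟨by positivity, ?_⟩
      have : (a : ℝ) + 1 ≤ k := by exact_mod_cast ha
      simp only [D]; push_cast
      have : (0:ℝ) < k + 1 := by positivity
      nlinarith
  have hθ : ∀ s ∈ S, 0 < θ s ∧ θ s < Real.pi := by
    intro s hs
    obtain ⟨a, b⟩ := hSb s hs
    have a' : (0:ℝ) < s := by exact_mod_cast a
    refine ⟨by positivity, ?_⟩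
    simp only [θ]
    rw [div_lt_iff₀ hD]
    nlinarith
  have hroot : ∀ s ∈ S, aeval (2 * Real.cos (θ s)) P0 = 0 := by
    intro s hs
    obtain ⟨t0, t1⟩ := hθ s hs
    have hsin : Real.sin (θ s) ≠ 0 := (Real.sin_pos_of_pos_of_lt_pi t0 t1).ne'
    obtain ⟨e1, e2⟩ := sig_sin h0 h1 h (θ s) k
    rw [hP0, map_mul, map_sub]
    rcases Finset.mem_union.1 hs with hs | hs
    · simp only [S1, Finset.mem_image, Finset.mem_range] at hs
      obtain ⟨a, ha, rfl⟩ := hs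
      have : ((k : ℝ) + 1) * θ ((a + 1) * (2 * k + 1)) = ((a + 1 : ℕ) : ℝ) * Real.pi := by
        simp only [θ, D]; push_cast; field_simp
      rw [this, Real.sin_nat_mul_pi] at e2
      rw [(mul_eq_zero.1 e2).resolve_right hsin, zero_mul]
    · simp only [S2, Finset.mem_image, Finset.mem_range] at hs
      obtain ⟨a, ha, rfl⟩ := hs
      set x := θ ((2 * a + 1) * (k + 1)) with hx
      have hx' : (k + 1 : ℝ) * x = ((a : ℝ) * (2 * Real.pi) + Real.pi) - k * x := by
        have : (2 * k + 1 : ℝ) * x = (2 * a + 1) * Real.pi := by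
          simp only [hx, θ, D]; push_cast; field_simp
        linarith
      have : Real.sin ((k + 1 : ℝ) * x) = Real.sin (k * x) := by
        rw [hx', show (a : ℝ) * (2 * Real.pi) + Real.pi - k * x = (Real.pi - k * x) + a * (2 * Real.pi) by ring,
          Real.sin_add_nat_mul_two_pi, Real.sin_pi_sub]
      have e3 : (aeval (2 * Real.cos x) (σ (k + 1)) - aeval (2 * Real.cos x) (σ k)) * Real.sin x = 0 := by
        rw [sub_mul, e1, e2, this, sub_self]
      rw [(mul_eq_zero.1 e3).resolve_right hsin, mul_zero]
  let T : Finset ℂ := S.image (fun s => ((2 * Real.cos (θ s) : ℝ) : ℂ))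
  have cT : T.card = 2 * k := by
    rw [Finset.card_image_of_injOn, cS]
    intro a ha b hb hab
    have h2 : Real.cos (θ a) = Real.cos (θ b) := by
      have : (2 * Real.cos (θ a) : ℝ) = 2 * Real.cos (θ b) := Complex.ofReal_injective hab
      linarith
    have h3 : θ a = θ b := Real.injOn_cos ⟨(hθ a ha).1.le, (hθ a ha).2.le⟩
      ⟨(hθ b hb).1.le, (hθ b hb).2.le⟩ h2
    have h4 : Real.pi * a = Real.pi * b := by
      simp only [θ] at h3
      rwa [div_left_inj' hD.ne'] at h3
    exact_mod_cast mul_left_cancel₀ hpi.ne' h4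
  have hPm : (P0.map (Int.castRingHom ℂ)).Monic := hm.map _
  have hle : T.val ≤ (P0.map (Int.castRingHom ℂ)).roots := by
    rw [Finset.val_le_iff_val_subset]
    intro z hz
    rw [Finset.mem_val, Finset.mem_image] at hz
    obtain ⟨s, hs, rfl⟩ := hz
    rw [mem_roots hPm.ne_zero, IsRoot.def, eval_map]
    have h5 := congrArg (algebraMap ℝ ℂ) (hroot s hs)
    rw [map_zero, ← aeval_algebraMap_apply] at h5
    exact h5
  have heq : T.val = (P0.map (Int.castRingHom ℂ)).roots := by
    refine Multiset.eq_of_le_of_card_le hle ?_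
    refine (card_roots' _).trans ?_
    rw [hm.natDegree_map, hd, Finset.card_val, cT]
  rw [← heq]
  exact T.nodup
end sigma2

theorem stmt17
    (σ : ℤ → Polynomial ℤ)
    (hσ0 : σ 0 = 0) (hσ1 : σ 1 = 1)
    (hσ : ∀ i : ℤ, σ (i + 1) = X * σ i - σ (i - 1))
    (Φ : ℤ → Polynomial ℤ)
    (hΦeven : ∀ i : ℤ, Φ (2 * i) = σ i)
    (hΦodd : ∀ i : ℤ, Φ (2 * i - 1) = σ i - σ (i - 1))
    (t : ℕ) (ht3 : 3 ≤ t) (htodd : Odd t)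
    (f : Polynomial (Polynomial ℤ))
    (hf : f = ((Φ t).map (Int.castRingHom (Polynomial ℤ)))
            * ((Φ (-(t : ℤ) - 1)).map (Int.castRingHom (Polynomial ℤ)))
            * (C (X ^ 2 - 2) - X) - 1)
    (Qab : IntermediateField ℚ ℂ)
    (hQab : Qab = IntermediateField.adjoin ℚ {z : ℂ | ∃ n : ℕ, 0 < n ∧ z ^ n = 1})
    (ζ : ℕ → ℂ) (hζ : ∀ n : ℕ, ζ n = Complex.exp (2 * Real.pi * I / n)) :
    {n : ℕ | 0 < n ∧ ∃ c : Qab, (c : ℂ) = ζ n + (ζ n)⁻¹ ∧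
      ¬ Irreducible (f.map ((aeval c).toRingHom : Polynomial ℤ →+* Qab))}.Finite := by
  obtain ⟨k, rfl⟩ := htodd
  have hk : 1 ≤ k := by omega
  obtain ⟨hm, hd⟩ := P0_monic hσ0 hσ1 hσ k
  have hnod := P0_nodup hσ0 hσ1 hσ k
  have hΦ1 : Φ ((2 * k + 1 : ℕ) : ℤ) = σ (k + 1) - σ k := by
    have := hΦodd (k + 1)
    rw [add_sub_cancel_right] at this
    rw [← this]; congr 1; push_cast; ring
  have hΦ2 : Φ (-((2 * k + 1 : ℕ) : ℤ) - 1) = - σ (k + 1) := by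
    rw [← (sig_neg hσ0 hσ k).2, ← hΦeven]; congr 1
  set P0 := σ (k + 1) * (σ (k + 1) - σ k) with hP0
  have hPm : (P0.map (Int.castRingHom ℂ)).Monic := hm.map _
  have hPd : (P0.map (Int.castRingHom ℂ)).natDegree = 2 * k := by rw [hm.natDegree_map, hd]
  obtain ⟨K, hK⟩ := descent hPm hnod (by rw [hPd]; exact even_two_mul k) (by omega)
  have hfP : f = P0.map (Int.castRingHom (Polynomial ℤ)) * (X - C (X ^ 2 - 2)) - 1 := by
    rw [hf, hΦ1, hΦ2, hP0]
    simp only [Polynomial.map_mul, Polynomial.map_neg, Polynomial.map_sub]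
    ring
  refine (Set.finite_Iic (2 * K)).subset ?_
  rintro n ⟨hn, c, hc, hirr⟩
  rw [Set.mem_Iic]
  have hζn : ζ n = xi n := by rw [hζ]; rfl
  have hxn := xi_prim hn
  have hx0 : xi n ≠ 0 := hxn.ne_zero hn.ne'
  have hF : f.map ((aeval c).toRingHom : Polynomial ℤ →+* Qab) =
      P0.map (Int.castRingHom Qab) * (X - C (c ^ 2 - 2)) - 1 := by
    rw [hfP]
    simp only [Polynomial.map_mul, Polynomial.map_sub, Polynomial.map_one, map_X, map_C,
      Polynomial.map_map]
    have : (((aeval c).toRingHom : ℤ[X] →+* Qab).comp (Int.castRingHom ℤ[X])) = Int.castRingHom Qab :=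
      RingHom.ext_int _ _
    rw [this]
    have e2 : (aeval c).toRingHom (X ^ 2 - 2 : ℤ[X]) = c ^ 2 - 2 := by
      rw [map_sub, map_pow, map_ofNat]; simp
    rw [e2]
  have hPQ : (P0.map (Int.castRingHom Qab)).Monic := hm.map _
  have hmul : (P0.map (Int.castRingHom Qab) * (X - C (c ^ 2 - 2))).Monic :=
    hPQ.mul (monic_X_sub_C _)
  have hmuld : (P0.map (Int.castRingHom Qab) * (X - C (c ^ 2 - 2))).natDegree = 2 * k + 1 := by
    rw [hPQ.natDegree_mul (monic_X_sub_C _), natDegree_X_sub_C, hm.natDegree_map, hd]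
  have hlt : (1 : Qab[X]).degree < (P0.map (Int.castRingHom Qab) * (X - C (c ^ 2 - 2))).degree := by
    rw [degree_eq_natDegree hmul.ne_zero, hmuld, degree_one]
    exact_mod_cast Nat.succ_pos _
  have hFm : (f.map ((aeval c).toRingHom : Polynomial ℤ →+* Qab)).Monic := by
    rw [hF]; exact hmul.sub_of_left hlt
  have hF1 : f.map ((aeval c).toRingHom : Polynomial ℤ →+* Qab) ≠ 1 := by
    intro h1
    have h2 := congrArg degree h1
    rw [hF, degree_sub_eq_left_of_degree_lt hlt] at h2
    exact hlt.ne' h2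
  rw [hFm.irreducible_iff_natDegree] at hirr
  push Not at hirr
  obtain ⟨g, g', hg, hg', hgg, hgd, hgd'⟩ := hirr hF1
  have hmapd : ∀ p : Qab[X], (p.map (algebraMap Qab ℂ)).natDegree = p.natDegree := fun p =>
    natDegree_map _
  have hcoe : ∀ p : Qab[X], ∀ a, (p.map (algebraMap Qab ℂ)).coeff a ∈
      IntermediateField.adjoin ℚ {z : ℂ | ∃ n : ℕ, 0 < n ∧ z ^ n = 1} := by
    intro p a
    rw [coeff_map, ← hQab]
    exact (p.coeff a).2
  obtain ⟨M, hM, hfac⟩ := initial (P0 := P0) hm hn (g := g.map (algebraMap Qab ℂ))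
    (g' := g'.map (algebraMap Qab ℂ)) (hg.map _) (hg'.map _)
    (by rw [hmapd]; omega) (by rw [hmapd]; omega) (hcoe g) (hcoe g') (by
      rw [← Polynomial.map_mul, hgg, hF]
      simp only [Polynomial.map_mul, Polynomial.map_sub, Polynomial.map_one, map_X, map_C,
        Polynomial.map_map]
      have e1 : (algebraMap Qab ℂ).comp (Int.castRingHom Qab) = Int.castRingHom ℂ :=
        RingHom.ext_int _ _
      have e2 : algebraMap Qab ℂ (c ^ 2 - 2) = xi n ^ 2 + (xi n ^ 2)⁻¹ := by
        have e3 : algebraMap Qab ℂ c = xi n + (xi n)⁻¹ := by rw [← hζn]; exact hc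
        rw [map_sub, map_pow, e3, map_ofNat]
        field_simp
        ring
      rw [e1, e2])
  have hN := hK _ _ hM hfac
  have hpos : 0 < orderOf (xi n ^ 2) := by
    rw [orderOf_pos_iff]
    exact isOfFinOrder_iff_pow_eq_one.2 ⟨n, hn, by rw [← pow_mul, mul_comm, pow_mul, hxn.pow_eq_one, one_pow]⟩
  have hdvd : n ∣ 2 * orderOf (xi n ^ 2) := by
    rw [← hxn.pow_eq_one_iff_dvd, pow_mul, pow_orderOf_eq_one]
  have := Nat.le_of_dvd (by omega) hdvd
  omega
end
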